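/- Let R be a commutative noetherian ring, C a semidualizing R-module, and n ≥ 1. Then H_C^n(F_C(R)) = GF_C(R) ∩ B_C(R); that is, an R-module lies in the n-fold iterate H_C^n applied to the class of C-flat R-modules if and only if it is G_C-flat and lies in the Bass class B_C(R). -/

import Mathlib

open CategoryTheory TensorProduct

universe u

section
variable (R : Type u) [CommRing R]

def extZero (M N : ModuleCat.{u} R) : Prop :=
  ∀ i : ℕ, 1 ≤ i → Subsingleton (((Ext R (ModuleCat.{u} R) i).obj (Opposite.op M)).obj N)

def torZero (M N : ModuleCat.{u} R) : Prop :=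
  ∀ i : ℕ, 1 ≤ i → Subsingleton (((Tor (ModuleCat.{u} R) i).obj M).obj N)

def IsSemidualizing (C : ModuleCat.{u} R) : Prop :=
  Module.Finite R C ∧ Function.Bijective (LinearMap.lsmul R C) ∧ extZero R C C

/-- A module is `C`-flat if it is isomorphic to `F ⊗[R] C` with `F` flat. -/
def IsCFlat (C M : ModuleCat.{u} R) : Prop :=
  ∃ F : ModuleCat.{u} R, Module.Flat R F ∧ Nonempty (M ≃ₗ[R] (F ⊗[R] C))

def IsCInjective (C M : ModuleCat.{u} R) : Prop :=
  ∃ I : ModuleCat.{u} R, Module.Injective R I ∧ Nonempty (M ≃ₗ[R] (↥C →ₗ[R] ↥I))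

/-- cotorsion: `Ext^{≥1}(F, N) = 0` for all flat `F`. -/
def IsCotorsion (N : ModuleCat.{u} R) : Prop :=
  ∀ F : ModuleCat.{u} R, Module.Flat R F → extZero R F N

/-- `C`-cotorsion: `Ext^{≥1}(F ⊗ C, N) = 0` for all flat `F`. -/
def IsCCotorsion (C N : ModuleCat.{u} R) : Prop :=
  ∀ F : ModuleCat.{u} R, Module.Flat R F →
    extZero R (ModuleCat.of R (↥F ⊗[R] ↥C)) N

/-- `C`-flat `C`-cotorsion: isomorphic to `F ⊗ C` with `F` flat and cotorsion. -/
def IsCFlatCotorsion (C M : ModuleCat.{u} R) : Prop :=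
  ∃ F : ModuleCat.{u} R, Module.Flat R F ∧ IsCotorsion R F ∧
    Nonempty (M ≃ₗ[R] (F ⊗[R] C))

/-- The natural evaluation map `C ⊗ Hom(C,M) → M`. -/
noncomputable def evalMap (C M : ModuleCat.{u} R) :
    (↥C ⊗[R] (↥C →ₗ[R] ↥M)) →ₗ[R] ↥M :=
  TensorProduct.lift (LinearMap.id (R := R) (M := ↥C →ₗ[R] ↥M)).flip

/-- The Bass class `B_C(R)`. -/
noncomputable def InBassClass (C M : ModuleCat.{u} R) : Prop :=
  extZero R C M ∧
  torZero R C (ModuleCat.of R (↥C →ₗ[R] ↥M)) ∧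
  Function.Bijective (evalMap R C M)

/-- A `ℤ`-indexed complex of `R`-modules: `d i : X (i+1) → X i`. -/
structure ZComplex where
  X : ℤ → ModuleCat.{u} R
  d : ∀ i : ℤ, ↥(X (i + 1)) →ₗ[R] ↥(X i)
  d_comp_d : ∀ i : ℤ, (d i).comp (d (i + 1)) = 0

namespace ZComplex

variable {R} (Z : ZComplex R)

/-- Exactness of the complex. -/
def IsExact : Prop := ∀ i : ℤ, Function.Exact (Z.d (i + 1)) (Z.d i)

/-- Exactness of `Z ⊗[R] J`. -/
def TensorExact (J : ModuleCat.{u} R) : Prop :=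
  ∀ i : ℤ, Function.Exact (LinearMap.rTensor (↥J) (Z.d (i + 1)))
    (LinearMap.rTensor (↥J) (Z.d i))

/-- Exactness of `Hom_R(V, Z)`. -/
def HomFromExact (V : ModuleCat.{u} R) : Prop :=
  ∀ i : ℤ, Function.Exact
    (fun f : ↥V →ₗ[R] ↥(Z.X (i + 1 + 1)) => (Z.d (i + 1)).comp f)
    (fun f : ↥V →ₗ[R] ↥(Z.X (i + 1)) => (Z.d i).comp f)

/-- Exactness of `Hom_R(Z, V)`. -/
def HomToExact (V : ModuleCat.{u} R) : Prop :=
  ∀ i : ℤ, Function.Exact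
    (fun g : ↥(Z.X i) →ₗ[R] ↥V => g.comp (Z.d i))
    (fun g : ↥(Z.X (i + 1)) →ₗ[R] ↥V => g.comp (Z.d (i + 1)))

/-- `M ≅ Coker(∂₁)`. -/
def IsCokerOfD1 (M : ModuleCat.{u} R) : Prop :=
  Nonempty (↥M ≃ₗ[R] (↥(Z.X 0) ⧸ LinearMap.range (Z.d 0)))

end ZComplex

end

section
variable (R : Type u) [CommRing R]

/-- A complete `FF_C`-resolution witnessing that `M` is `G_C`-flat. -/
def IsGCFlat (C M : ModuleCat.{u} R) : Prop :=
  ∃ Z : ZComplex R, Z.IsExact ∧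
    (∀ i : ℤ, 0 ≤ i → Module.Flat R (Z.X i)) ∧
    (∀ i : ℤ, i < 0 → IsCFlat R C (Z.X i)) ∧
    (∀ J : ModuleCat.{u} R, IsCInjective R C J → Z.TensorExact J) ∧
    Z.IsCokerOfD1 M

def IsCProjective (C M : ModuleCat.{u} R) : Prop :=
  ∃ P : ModuleCat.{u} R, Module.Projective R P ∧ Nonempty (M ≃ₗ[R] (P ⊗[R] C))

/-- A complete `PP_C`-resolution witnessing that `M` is `G_C`-projective. -/
def IsGCProjective (C M : ModuleCat.{u} R) : Prop :=
  ∃ Z : ZComplex R, Z.IsExact ∧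
    (∀ i : ℤ, 0 ≤ i → Module.Projective R (Z.X i)) ∧
    (∀ i : ℤ, i < 0 → IsCProjective R C (Z.X i)) ∧
    (∀ Q : ModuleCat.{u} R, IsCProjective R C Q → Z.HomToExact Q) ∧
    Z.IsCokerOfD1 M

/-- `G(𝒳)` for a class `𝒳` of modules. -/
def GClass (𝒳 : ModuleCat.{u} R → Prop) (M : ModuleCat.{u} R) : Prop :=
  ∃ Z : ZComplex R, Z.IsExact ∧
    (∀ i : ℤ, 𝒳 (Z.X i)) ∧
    (∀ V : ModuleCat.{u} R, 𝒳 V → Z.HomFromExact V) ∧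
    (∀ V : ModuleCat.{u} R, 𝒳 V → Z.HomToExact V) ∧
    Z.IsCokerOfD1 M

/-- Iterates `G^n(𝒳)`, with `G^0(𝒳) = 𝒳`. -/
def GIter : ℕ → (ModuleCat.{u} R → Prop) → (ModuleCat.{u} R → Prop)
  | 0, 𝒳 => 𝒳
  | n + 1, 𝒳 => GClass R (GIter n 𝒳)

/-- `H_C(𝒳)`: modules with a `P_C F_C^cot`-complete `𝒳`-resolution. -/
def HClass (C : ModuleCat.{u} R) (𝒳 : ModuleCat.{u} R → Prop) (M : ModuleCat.{u} R) : Prop :=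
  ∃ Z : ZComplex R, Z.IsExact ∧
    (∀ i : ℤ, 𝒳 (Z.X i)) ∧
    (∀ P : ModuleCat.{u} R, Module.Projective R P →
      Z.HomFromExact (ModuleCat.of R (↥P ⊗[R] ↥C))) ∧
    (∀ N : ModuleCat.{u} R, IsCFlatCotorsion R C N → Z.HomToExact N) ∧
    Z.IsCokerOfD1 M

/-- Iterates `H_C^n(𝒳)`, with `H_C^0(𝒳) = 𝒳`. -/
def HIter (C : ModuleCat.{u} R) : ℕ → (ModuleCat.{u} R → Prop) → (ModuleCat.{u} R → Prop)
  | 0, 𝒳 => 𝒳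
  | n + 1, 𝒳 => HClass R C (HIter C n 𝒳)

/-- `M` admits a resolution `0 → X_n → ⋯ → X_0 → M → 0` with each `X_i` in `𝒳`. -/
def HasResOfLength (𝒳 : ModuleCat.{u} R → Prop) (n : ℕ) (M : ModuleCat.{u} R) : Prop :=
  ∃ (P : ℕ → ModuleCat.{u} R) (d : ∀ i : ℕ, ↥(P (i + 1)) →ₗ[R] ↥(P i))
    (ε : ↥(P 0) →ₗ[R] ↥M),
      Function.Surjective ε ∧ Function.Exact (d 0) ε ∧
      (∀ i : ℕ, Function.Exact (d (i + 1)) (d i)) ∧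
      (∀ i : ℕ, i ≤ n → 𝒳 (P i)) ∧
      (∀ i : ℕ, n < i → Subsingleton (P i))

/-- `M` admits a coresolution `0 → M → Y_0 → ⋯ → Y_n → 0` with each `Y_i` in `𝒳`. -/
def HasCoresOfLength (𝒳 : ModuleCat.{u} R → Prop) (n : ℕ) (M : ModuleCat.{u} R) : Prop :=
  ∃ (P : ℕ → ModuleCat.{u} R) (d : ∀ i : ℕ, ↥(P i) →ₗ[R] ↥(P (i + 1)))
    (η : ↥M →ₗ[R] ↥(P 0)),
      Function.Injective η ∧ Function.Exact η (d 0) ∧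
      (∀ i : ℕ, Function.Exact (d i) (d (i + 1))) ∧
      (∀ i : ℕ, i ≤ n → 𝒳 (P i)) ∧
      (∀ i : ℕ, n < i → Subsingleton (P i))

/-- `C` is a dualizing module: semidualizing of finite injective dimension. -/
def IsDualizing (C : ModuleCat.{u} R) : Prop :=
  IsSemidualizing R C ∧
  ∃ n : ℕ, HasCoresOfLength R (fun I => Module.Injective R ↥I) n C

end

/-- A short exact sequence `0 → A → B → D → 0` of modules. -/
structure IsSES {R : Type u} [CommRing R] {A B D : Type u} [AddCommGroup A] [AddCommGroup B]
    [AddCommGroup D] [Module R A] [Module R B] [Module R D] (f : A →ₗ[R] B) (g : B →ₗ[R] D) :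
    Prop where
  inj : Function.Injective f
  exact : Function.Exact f g
  surj : Function.Surjective g

/-- The vanishing of `Ext^n(A, B)`. -/
def ExtVanish (R : Type u) [CommRing R] (A B : Type u) [AddCommGroup A] [Module R A]
    [AddCommGroup B] [Module R B] (n : ℕ) : Prop :=
  Subsingleton (Abelian.Ext.{u} (ModuleCat.of R A) (ModuleCat.of R B) n)

/-- The vanishing of `Ext^i(A, B)` for all `i ≥ 1`. -/
def ExtPosVanish (R : Type u) [CommRing R] (A B : Type u) [AddCommGroup A] [Module R A]
    [AddCommGroup B] [Module R B] : Prop :=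
  ∀ n : ℕ, ExtVanish R A B (n + 1)

section ExtVanish

variable {R : Type u} [CommRing R]
variable {A B D A' B' V : Type u} [AddCommGroup A] [AddCommGroup B] [AddCommGroup D]
  [AddCommGroup A'] [AddCommGroup B'] [AddCommGroup V]
  [Module R A] [Module R B] [Module R D] [Module R A'] [Module R B'] [Module R V]
  {f : A →ₗ[R] B} {g : B →ₗ[R] D}

namespace IsSES

/-- The short complex in `ModuleCat` underlying a short exact sequence. -/
abbrev shortComplex (h : IsSES f g) : ShortComplex (ModuleCat.{u} R) :=
  ShortComplex.mk (ModuleCat.ofHom f) (ModuleCat.ofHom g) (by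
    ext x
    exact h.exact.apply_apply_eq_zero x)

lemma shortExact (h : IsSES f g) : h.shortComplex.ShortExact where
  exact := (ShortComplex.ShortExact.moduleCat_exact_iff_function_exact _).mpr h.exact
  mono_f := (ModuleCat.mono_iff_injective _).mpr h.inj
  epi_g := (ModuleCat.epi_iff_surjective _).mpr h.surj

lemma lift_of_extVanish (h : IsSES f g) (hA : ExtVanish R V A 1) (k : V →ₗ[R] D) :
    ∃ l : V →ₗ[R] B, g.comp l = k := by
  have : Subsingleton (Abelian.Ext.{u} (ModuleCat.of R V) h.shortComplex.X₁ 1) := hA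
  obtain ⟨x, hx⟩ := Abelian.Ext.covariant_sequence_exact₃ (ModuleCat.of R V) h.shortExact
    (Abelian.Ext.mk₀ (ModuleCat.ofHom k)) (zero_add 1) (Subsingleton.elim _ _)
  refine ⟨(Abelian.Ext.addEquiv₀ x).hom, ?_⟩
  rw [← Abelian.Ext.mk₀_addEquiv₀_apply x, Abelian.Ext.mk₀_comp_mk₀] at hx
  have := congrArg ModuleCat.Hom.hom (Abelian.Ext.addEquiv₀.symm.injective hx)
  exact this

lemma extend_of_extVanish (h : IsSES f g) (hD : ExtVanish R D V 1) (k : A →ₗ[R] V) :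
    ∃ l : B →ₗ[R] V, l.comp f = k := by
  have : Subsingleton (Abelian.Ext.{u} h.shortComplex.X₃ (ModuleCat.of R V) 1) := hD
  obtain ⟨x, hx⟩ := Abelian.Ext.contravariant_sequence_exact₁ h.shortExact (ModuleCat.of R V)
    (Abelian.Ext.mk₀ (ModuleCat.ofHom k)) (add_zero 1) (Subsingleton.elim _ _)
  refine ⟨(Abelian.Ext.addEquiv₀ x).hom, ?_⟩
  rw [← Abelian.Ext.mk₀_addEquiv₀_apply x, Abelian.Ext.mk₀_comp_mk₀] at hx
  have := congrArg ModuleCat.Hom.hom (Abelian.Ext.addEquiv₀.symm.injective hx)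
  exact this

lemma extVanish_left_of_lift (h : IsSES f g) (hl : ∀ k : V →ₗ[R] D, ∃ l : V →ₗ[R] B, g.comp l = k)
    (hB : ExtVanish R V B 1) : ExtVanish R V A 1 := by
  have : Subsingleton (Abelian.Ext.{u} (ModuleCat.of R V) h.shortComplex.X₂ 1) := hB
  refine subsingleton_of_forall_eq 0 fun x ↦ ?_
  obtain ⟨y, hy⟩ := Abelian.Ext.covariant_sequence_exact₁ (ModuleCat.of R V) h.shortExact x
    (Subsingleton.elim _ _) (zero_add 1)
  obtain ⟨l, hl⟩ := hl (Abelian.Ext.addEquiv₀ y).hom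
  have : y = (Abelian.Ext.mk₀ (ModuleCat.ofHom l)).comp (Abelian.Ext.mk₀ h.shortComplex.g)
      (zero_add 0) := by
    rw [← Abelian.Ext.mk₀_addEquiv₀_apply y, Abelian.Ext.mk₀_comp_mk₀]
    congr 1
    ext1
    exact hl.symm
  rw [← hy, this]
  rw [Abelian.Ext.comp_assoc_of_second_deg_zero, h.shortExact.comp_extClass, Abelian.Ext.comp_zero]

lemma extVanish_right_of_extend (h : IsSES f g)
    (hl : ∀ k : A →ₗ[R] V, ∃ l : B →ₗ[R] V, l.comp f = k)
    (hB : ExtVanish R B V 1) : ExtVanish R D V 1 := by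
  have : Subsingleton (Abelian.Ext.{u} h.shortComplex.X₂ (ModuleCat.of R V) 1) := hB
  refine subsingleton_of_forall_eq 0 fun x ↦ ?_
  obtain ⟨y, hy⟩ := Abelian.Ext.contravariant_sequence_exact₃ h.shortExact (ModuleCat.of R V) x
    (Subsingleton.elim _ _) (add_zero 1)
  obtain ⟨l, hl⟩ := hl (Abelian.Ext.addEquiv₀ y).hom
  have : y = (Abelian.Ext.mk₀ h.shortComplex.f).comp (Abelian.Ext.mk₀ (ModuleCat.ofHom l))
      (zero_add 0) := by
    rw [← Abelian.Ext.mk₀_addEquiv₀_apply y, Abelian.Ext.mk₀_comp_mk₀]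
    congr 1
    ext1
    exact hl.symm
  rw [← hy, this]
  exact h.shortExact.extClass_comp_assoc _

lemma extVanish_to_left (h : IsSES f g) {n : ℕ} (hD : ExtVanish R V D n)
    (hB : ExtVanish R V B (n + 1)) : ExtVanish R V A (n + 1) := by
  have : Subsingleton (Abelian.Ext.{u} (ModuleCat.of R V) h.shortComplex.X₂ (n + 1)) := hB
  have : Subsingleton (Abelian.Ext.{u} (ModuleCat.of R V) h.shortComplex.X₃ n) := hD
  refine subsingleton_of_forall_eq 0 fun x ↦ ?_
  obtain ⟨y, hy⟩ := Abelian.Ext.covariant_sequence_exact₁ (ModuleCat.of R V) h.shortExact x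
    (Subsingleton.elim _ _) rfl
  rw [← hy, Subsingleton.elim y 0]
  simp

lemma extVanish_to_right (h : IsSES f g) {n : ℕ} (hA : ExtVanish R V A (n + 1))
    (hB : ExtVanish R V B n) : ExtVanish R V D n := by
  have : Subsingleton (Abelian.Ext.{u} (ModuleCat.of R V) h.shortComplex.X₂ n) := hB
  have : Subsingleton (Abelian.Ext.{u} (ModuleCat.of R V) h.shortComplex.X₁ (n + 1)) := hA
  refine subsingleton_of_forall_eq 0 fun x ↦ ?_
  obtain ⟨y, hy⟩ := Abelian.Ext.covariant_sequence_exact₃ (ModuleCat.of R V) h.shortExact x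
    rfl (Subsingleton.elim _ _)
  rw [← hy, Subsingleton.elim y 0]
  simp

lemma extVanish_to_middle (h : IsSES f g) {n : ℕ} (hA : ExtVanish R V A n)
    (hD : ExtVanish R V D n) : ExtVanish R V B n := by
  have : Subsingleton (Abelian.Ext.{u} (ModuleCat.of R V) h.shortComplex.X₃ n) := hD
  have : Subsingleton (Abelian.Ext.{u} (ModuleCat.of R V) h.shortComplex.X₁ n) := hA
  refine subsingleton_of_forall_eq 0 fun x ↦ ?_
  obtain ⟨y, hy⟩ := Abelian.Ext.covariant_sequence_exact₂ (ModuleCat.of R V) h.shortExact x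
    (Subsingleton.elim _ _)
  rw [← hy, Subsingleton.elim y 0]
  simp

lemma extVanish_from_right (h : IsSES f g) {n : ℕ} (hA : ExtVanish R A V n)
    (hB : ExtVanish R B V (n + 1)) : ExtVanish R D V (n + 1) := by
  have : Subsingleton (Abelian.Ext.{u} h.shortComplex.X₂ (ModuleCat.of R V) (n + 1)) := hB
  have : Subsingleton (Abelian.Ext.{u} h.shortComplex.X₁ (ModuleCat.of R V) n) := hA
  refine subsingleton_of_forall_eq 0 fun x ↦ ?_
  obtain ⟨y, hy⟩ := Abelian.Ext.contravariant_sequence_exact₃ h.shortExact (ModuleCat.of R V) x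
    (Subsingleton.elim _ _) (add_comm 1 n)
  rw [← hy, Subsingleton.elim y 0]
  simp

lemma extVanish_from_left (h : IsSES f g) {n : ℕ} (hB : ExtVanish R B V n)
    (hD : ExtVanish R D V (n + 1)) : ExtVanish R A V n := by
  have : Subsingleton (Abelian.Ext.{u} h.shortComplex.X₂ (ModuleCat.of R V) n) := hB
  have : Subsingleton (Abelian.Ext.{u} h.shortComplex.X₃ (ModuleCat.of R V) (n + 1)) := hD
  refine subsingleton_of_forall_eq 0 fun x ↦ ?_
  obtain ⟨y, hy⟩ := Abelian.Ext.contravariant_sequence_exact₁ h.shortExact (ModuleCat.of R V) x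
    (add_comm 1 n) (Subsingleton.elim _ _)
  rw [← hy, Subsingleton.elim y 0]
  simp

lemma extVanish_from_middle (h : IsSES f g) {n : ℕ} (hA : ExtVanish R A V n)
    (hD : ExtVanish R D V n) : ExtVanish R B V n := by
  have : Subsingleton (Abelian.Ext.{u} h.shortComplex.X₁ (ModuleCat.of R V) n) := hA
  have : Subsingleton (Abelian.Ext.{u} h.shortComplex.X₃ (ModuleCat.of R V) n) := hD
  refine subsingleton_of_forall_eq 0 fun x ↦ ?_
  obtain ⟨y, hy⟩ := Abelian.Ext.contravariant_sequence_exact₂ h.shortExact (ModuleCat.of R V) x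
    (Subsingleton.elim _ _)
  rw [← hy, Subsingleton.elim y 0]
  simp

end IsSES

lemma extPosVanish_of_projective [Module.Projective R A] : ExtPosVanish R A B := fun n ↦ by
  have : Projective (ModuleCat.of R A) := (IsProjective.iff_projective _).mp inferInstance
  exact Abelian.Ext.subsingleton_of_projective _ _ n

lemma extPosVanish_of_injective [Module.Injective R B] : ExtPosVanish R A B := fun n ↦ by
  have : Injective (ModuleCat.of R B) := Module.injective_object_of_injective_module R B
  exact Abelian.Ext.subsingleton_of_injective _ _ n

lemma isSES_of_equiv (e : A ≃ₗ[R] A') :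
    IsSES (e : A →ₗ[R] A') (0 : A' →ₗ[R] PUnit.{u + 1}) where
  inj := e.injective
  exact := fun x ↦ by simp
  surj := fun x ↦ ⟨0, Subsingleton.elim _ _⟩

lemma ExtVanish.congr {n : ℕ} (h : ExtVanish R A B n) (e : A ≃ₗ[R] A') (e' : B ≃ₗ[R] B') :
    ExtVanish R A' B' n := by
  have : Subsingleton (Abelian.Ext.{u} (ModuleCat.of R A) (ModuleCat.of R B) n) := h
  refine subsingleton_of_forall_eq 0 fun x ↦ ?_
  have h1 : ((Abelian.Ext.mk₀ e.toModuleIso.hom).comp x (zero_add n)).comp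
      (Abelian.Ext.mk₀ e'.toModuleIso.inv) (add_zero n) = 0 := Subsingleton.elim _ _
  have h2 : x = (Abelian.Ext.mk₀ e.toModuleIso.inv).comp
      ((((Abelian.Ext.mk₀ e.toModuleIso.hom).comp x (zero_add n)).comp
      (Abelian.Ext.mk₀ e'.toModuleIso.inv) (add_zero n)).comp
        (Abelian.Ext.mk₀ e'.toModuleIso.hom) (add_zero n)) (zero_add n) := by
    rw [Abelian.Ext.comp_assoc_of_third_deg_zero, Abelian.Ext.mk₀_comp_mk₀, Iso.inv_hom_id,
      Abelian.Ext.comp_mk₀_id, Abelian.Ext.mk₀_comp_mk₀_assoc, Iso.inv_hom_id,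
      Abelian.Ext.mk₀_id_comp]
  rw [h2, h1]
  simp

lemma ExtPosVanish.congr (h : ExtPosVanish R A B) (e : A ≃ₗ[R] A') (e' : B ≃ₗ[R] B') :
    ExtPosVanish R A' B' :=
  fun n ↦ (h n).congr e e'

end ExtVanish

section Conversion

variable {R : Type u} [CommRing R]

lemma ModuleCat.subsingleton_iff_isZero (M : ModuleCat.{u} R) :
    Subsingleton M ↔ Limits.IsZero M :=
  ⟨fun _ ↦ ModuleCat.isZero_of_subsingleton M, fun h ↦ ModuleCat.subsingleton_of_isZero h⟩

lemma subsingleton_ext_iff_of_resolution {M N : ModuleCat.{u} R} (P : ProjectiveResolution M)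
    (n : ℕ) : Subsingleton (Abelian.Ext.{u} M N (n + 1)) ↔
      ∀ f : P.complex.X (n + 1) ⟶ N, P.complex.d (n + 2) (n + 1) ≫ f = 0 →
        ∃ g : P.complex.X n ⟶ N, P.complex.d (n + 1) n ≫ g = f := by
  constructor
  · intro _ f hf
    exact (P.extMk_eq_zero_iff f (n + 2) rfl hf n rfl).mp (Subsingleton.elim _ _)
  · intro h
    refine subsingleton_of_forall_eq 0 fun x ↦ ?_
    obtain ⟨f, hf, rfl⟩ := P.extMk_surjective x (n + 2) rfl
    exact (P.extMk_eq_zero_iff f (n + 2) rfl hf n rfl).mpr (h f hf)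

lemma subsingleton_old_ext_iff_of_resolution {M N : ModuleCat.{u} R} (P : ProjectiveResolution M)
    (n : ℕ) : Subsingleton (((Ext R (ModuleCat.{u} R) (n + 1)).obj (Opposite.op M)).obj N) ↔
      ∀ f : P.complex.X (n + 1) ⟶ N, P.complex.d (n + 2) (n + 1) ≫ f = 0 →
        ∃ g : P.complex.X n ⟶ N, P.complex.d (n + 1) n ≫ g = f := by
  rw [ModuleCat.subsingleton_iff_isZero, (P.isoExt (R := R) (n + 1) N).isZero_iff,
    ← HomologicalComplex.exactAt_iff_isZero_homology,
    HomologicalComplex.exactAt_iff' _ n (n + 1) (n + 2) (by simp) (by simp),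
    ShortComplex.moduleCat_exact_iff]
  rfl

lemma extZero_iff (M N : ModuleCat.{u} R) : extZero R M N ↔ ExtPosVanish R M N := by
  constructor
  · intro h n
    exact (subsingleton_ext_iff_of_resolution (projectiveResolution M) n).mpr
      ((subsingleton_old_ext_iff_of_resolution (projectiveResolution M) n).mp
        (h (n + 1) (by omega)))
  · intro h i hi
    obtain ⟨n, rfl⟩ : ∃ n, i = n + 1 := ⟨i - 1, by omega⟩
    exact (subsingleton_old_ext_iff_of_resolution (projectiveResolution M) n).mpr
      ((subsingleton_ext_iff_of_resolution (projectiveResolution M) n).mp (h n))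

end Conversion

section CharacterModule

variable {R : Type u} [CommRing R]
variable {A B D : Type u} [AddCommGroup A] [AddCommGroup B] [AddCommGroup D]
  [Module R A] [Module R B] [Module R D] {f : A →ₗ[R] B} {g : B →ₗ[R] D}

lemma CharacterModule.eq_of_forall_apply_eq {a b : A} (h : ∀ c : CharacterModule A, c a = c b) :
    a = b :=
  sub_eq_zero.mp (CharacterModule.eq_zero_of_character_apply fun c ↦ by rw [map_sub, h, sub_self])

lemma CharacterModule.exact_dual_iff :
    Function.Exact (CharacterModule.dual g) (CharacterModule.dual f) ↔ Function.Exact f g := by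
  constructor
  · intro h b
    constructor
    · intro hb
      by_contra hbf
      apply hbf
      have : (LinearMap.range f).mkQ b = 0 := CharacterModule.eq_zero_of_character_apply fun c ↦ by
        obtain ⟨e, he⟩ := (h (CharacterModule.dual (LinearMap.range f).mkQ c)).mp (by
          ext x
          have : (LinearMap.range f).mkQ (f x) = 0 := by simp
          change c ((LinearMap.range f).mkQ (f x)) = 0
          rw [this, map_zero])
        have : e (g b) = c ((LinearMap.range f).mkQ b) := DFunLike.congr_fun he b
        rw [← this, hb, map_zero]
      simpa using this
    · rintro ⟨a, rfl⟩
      refine CharacterModule.eq_zero_of_character_apply fun c ↦ ?_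
      exact DFunLike.congr_fun (h.apply_apply_eq_zero c) a
  · intro h c
    constructor
    · intro hc
      have hinj : Function.Injective ((LinearMap.ker g).liftQ g le_rfl) :=
        LinearMap.ker_eq_bot.mp (Submodule.ker_liftQ_eq_bot _ _ _ le_rfl)
      let c' : CharacterModule (B ⧸ LinearMap.ker g) :=
        QuotientAddGroup.lift (LinearMap.ker g).toAddSubgroup c (by
          intro b hb
          obtain ⟨a, rfl⟩ := (h b).mp hb
          exact DFunLike.congr_fun hc a)
      obtain ⟨e, he⟩ := CharacterModule.dual_surjective_of_injective _ hinj c'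
      refine ⟨e, ?_⟩
      ext b
      exact DFunLike.congr_fun he ((LinearMap.ker g).mkQ b)
    · rintro ⟨e, rfl⟩
      ext a
      change e (g (f a)) = 0
      rw [h.apply_apply_eq_zero, map_zero]

lemma exact_lcomp_characterModule_iff (V : Type u) [AddCommGroup V] [Module R V] :
    Function.Exact (g.lcomp R (CharacterModule V)) (f.lcomp R (CharacterModule V)) ↔
      Function.Exact (f.rTensor V) (g.rTensor V) := by
  rw [← CharacterModule.exact_dual_iff (f := f.rTensor V)]
  exact Function.Exact.iff_of_ladder_linearEquiv (e₁ := CharacterModule.homEquiv.symm)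
    (e₂ := CharacterModule.homEquiv.symm) (e₃ := CharacterModule.homEquiv.symm)
    (LinearMap.ext fun _ ↦ rfl) (LinearMap.ext fun _ ↦ rfl)

lemma exact_lTensor_iff_exact_rTensor (V : Type u) [AddCommGroup V] [Module R V] :
    Function.Exact (f.lTensor V) (g.lTensor V) ↔ Function.Exact (f.rTensor V) (g.rTensor V) :=
  Function.Exact.iff_of_ladder_linearEquiv (e₁ := TensorProduct.comm R _ _)
    (e₂ := TensorProduct.comm R _ _) (e₃ := TensorProduct.comm R _ _)
    (by ext x y; rfl) (by ext x y; rfl)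

lemma torZero_iff (C N : ModuleCat.{u} R) :
    torZero R C N ↔ ExtPosVanish R N (CharacterModule C) := by
  have key (n : ℕ) : Subsingleton (((Tor (ModuleCat.{u} R) (n + 1)).obj C).obj N) ↔
      ExtVanish R N (CharacterModule C) (n + 1) := by
    let P := projectiveResolution N
    rw [ExtVanish, subsingleton_ext_iff_of_resolution P n, ModuleCat.subsingleton_iff_isZero]
    erw [
      (P.isoLeftDerivedObj ((MonoidalCategory.tensoringLeft _).obj C) (n + 1)).isZero_iff]
    erw [← HomologicalComplex.exactAt_iff_isZero_homology]
    rw [HomologicalComplex.exactAt_iff' _ (n + 2) (n + 1) n (by simp) (by simp),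
      ShortComplex.ShortExact.moduleCat_exact_iff_function_exact]
    change Function.Exact ((P.complex.d (n + 2) (n + 1)).hom.lTensor C)
      ((P.complex.d (n + 1) n).hom.lTensor C) ↔ _
    rw [exact_lTensor_iff_exact_rTensor, ← exact_lcomp_characterModule_iff]
    constructor
    · intro h f hf
      obtain ⟨g, hg⟩ := (h f.hom).mp (congrArg ModuleCat.Hom.hom hf)
      exact ⟨ModuleCat.ofHom g, ModuleCat.hom_ext hg⟩
    · intro h f
      constructor
      · intro hf
        obtain ⟨g, hg⟩ := h (ModuleCat.ofHom f) (ModuleCat.hom_ext hf)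
        exact ⟨g.hom, congrArg ModuleCat.Hom.hom hg⟩
      · rintro ⟨g, rfl⟩
        refine LinearMap.ext fun x ↦ ?_
        have := congrArg (fun k ↦ k.hom x) (P.complex.d_comp_d (n + 2) (n + 1) n)
        change g ((P.complex.d (n + 1) n).hom ((P.complex.d (n + 2) (n + 1)).hom x)) = 0
        erw [this]
        simp
  constructor
  · intro h n
    exact (key n).mp (h (n + 1) (by omega))
  · intro h i hi
    obtain ⟨n, rfl⟩ : ∃ n, i = n + 1 := ⟨i - 1, by omega⟩
    exact (key n).mpr (h n)

end CharacterModule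

section FinitelyGenerated

variable {R : Type u} [CommRing R]

/-- A finitely generated module over a noetherian ring is a quotient of a finitely generated
free module by a finitely generated submodule. -/
lemma exists_finite_free_presentation [IsNoetherianRing R] (A : Type u) [AddCommGroup A]
    [Module R A] [Module.Finite R A] :
    ∃ (n : ℕ) (p : (Fin n → R) →ₗ[R] A), Module.Finite R (LinearMap.ker p) ∧
      IsSES (LinearMap.ker p).subtype p := by
  obtain ⟨n, p, hp⟩ := Module.Finite.exists_fin' R A
  exact ⟨n, p, inferInstance, Subtype.val_injective, p.exact_subtype_ker_map, hp⟩

variable {A B D V : Type u} [AddCommGroup A] [AddCommGroup B] [AddCommGroup D] [AddCommGroup V]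
  [Module R A] [Module R B] [Module R D] [Module R V] {f : A →ₗ[R] B} {g : B →ₗ[R] D}

lemma exists_comp_eq_of_injective [Module.Injective R V] (h : Function.Exact f g)
    (u : B →ₗ[R] V) (hu : u.comp f = 0) : ∃ w : D →ₗ[R] V, w.comp g = u := by
  have hinj : Function.Injective ((LinearMap.ker g).liftQ g le_rfl) :=
    LinearMap.ker_eq_bot.mp (Submodule.ker_liftQ_eq_bot _ _ _ le_rfl)
  obtain ⟨w, hw⟩ := Module.Injective.out _ hinj ((LinearMap.ker g).liftQ u (by
    intro b hb
    obtain ⟨a, rfl⟩ := (h b).mp hb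
    exact LinearMap.congr_fun hu a))
  exact ⟨w, LinearMap.ext fun b ↦ hw ((LinearMap.ker g).mkQ b)⟩

lemma exists_comp_eq_of_exact (h : Function.Exact f g) (hf : Function.Injective f)
    (u : V →ₗ[R] B) (hu : g.comp u = 0) : ∃ w : V →ₗ[R] A, f.comp w = u := by
  have (x : V) : ∃ a, f a = u x := (h _).mp (LinearMap.congr_fun hu x)
  choose w hw using this
  exact ⟨{ toFun := w
           map_add' := fun x y ↦ hf (by simp [hw])
           map_smul' := fun r x ↦ hf (by simp [hw]) }, LinearMap.ext hw⟩

lemma exists_comp_eq_of_exact_of_surjective (h : Function.Exact f g) (hg : Function.Surjective g)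
    (u : B →ₗ[R] V) (hu : u.comp f = 0) : ∃ w : D →ₗ[R] V, w.comp g = u := by
  choose s hs using hg
  have hk (b b' : B) (hb : g b = g b') : u b = u b' := by
    obtain ⟨a, ha⟩ := (h (b - b')).mp (by simp [hb])
    have := LinearMap.congr_fun hu a
    rw [← sub_eq_zero, ← map_sub, ← ha]
    exact this
  exact ⟨{ toFun := fun d ↦ u (s d)
           map_add' := fun x y ↦ by rw [← map_add]; exact hk _ _ (by simp [hs])
           map_smul' := fun r x ↦ by rw [← map_smul]; exact hk _ _ (by simp [hs]) },
    LinearMap.ext fun b ↦ hk _ _ (hs _)⟩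

lemma exact_lcomp_of_surjective (h : Function.Exact f g) (hg : Function.Surjective g) :
    Function.Exact (g.lcomp R V) (f.lcomp R V) := by
  intro u
  constructor
  · exact fun hu ↦ exists_comp_eq_of_exact_of_surjective h hg u hu
  · rintro ⟨w, rfl⟩
    refine LinearMap.ext fun a ↦ ?_
    change w (g (f a)) = 0
    rw [h.apply_apply_eq_zero, map_zero]

lemma lcomp_injective_of_surjective (hg : Function.Surjective g) :
    Function.Injective (g.lcomp R V) := by
  intro u v huv
  refine LinearMap.ext fun d ↦ ?_
  obtain ⟨b, rfl⟩ := hg d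
  exact LinearMap.congr_fun huv b

lemma lTensorHomToHomLTensor_comp_lTensor_lcomp (k : A →ₗ[R] B) :
    (lTensorHomToHomLTensor (RingHom.id R) A D V) ∘ₗ (k.lcomp R V).lTensor D =
      k.lcomp R (D ⊗[R] V) ∘ₗ (lTensorHomToHomLTensor (RingHom.id R) B D V) := by
  ext
  rfl

lemma lTensorHomToHomLTensor_injective [Module.Finite R A] [Module.Flat R D] :
    Function.Injective (lTensorHomToHomLTensor (RingHom.id R) A D V) := by
  obtain ⟨n, p, hp⟩ := Module.Finite.exists_fin' R A
  have h1 : Function.Injective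
      ((lTensorHomToHomLTensor (RingHom.id R) (Fin n → R) D V) ∘ₗ (p.lcomp R V).lTensor D) := by
    rw [← lTensorHomEquivHomLTensor_toLinearMap]
    exact (lTensorHomEquivHomLTensor R (Fin n → R) D V).injective.comp
      (Module.Flat.lTensor_preserves_injective_linearMap _ (lcomp_injective_of_surjective hp))
  rw [lTensorHomToHomLTensor_comp_lTensor_lcomp] at h1
  rw [LinearMap.coe_comp] at h1
  exact Function.Injective.of_comp h1

lemma lTensorHomToHomLTensor_bijective [IsNoetherianRing R] [Module.Finite R A]
    [Module.Flat R D] :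
    Function.Bijective (lTensorHomToHomLTensor (RingHom.id R) A D V) := by
  refine ⟨lTensorHomToHomLTensor_injective, fun k ↦ ?_⟩
  obtain ⟨n, p, hK, hp⟩ := exists_finite_free_presentation A (R := R)
  have hs : Function.Surjective (lTensorHomToHomLTensor (RingHom.id R) (Fin n → R) D V) := by
    rw [← lTensorHomEquivHomLTensor_toLinearMap]
    exact (lTensorHomEquivHomLTensor R (Fin n → R) D V).surjective
  obtain ⟨t, ht⟩ := hs (k.comp p)
  have ht0 : ((LinearMap.ker p).subtype.lcomp R V).lTensor D t = 0 := by
    apply lTensorHomToHomLTensor_injective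
    have := LinearMap.congr_fun (lTensorHomToHomLTensor_comp_lTensor_lcomp (D := D) (V := V)
      (LinearMap.ker p).subtype) t
    rw [LinearMap.comp_apply, LinearMap.comp_apply, ht] at this
    rw [this, map_zero]
    ext x
    change k (p x) = 0
    rw [x.2, map_zero]
  obtain ⟨s, rfl⟩ := (Module.Flat.lTensor_exact D
    (exact_lcomp_of_surjective (V := V) hp.exact hp.surj) t).mp ht0
  refine ⟨s, lcomp_injective_of_surjective hp.surj ?_⟩
  change _ = k.comp p
  rw [← ht]
  exact (LinearMap.congr_fun (lTensorHomToHomLTensor_comp_lTensor_lcomp (D := D) (V := V) p) s).symm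

variable (R A B V) in
/-- The natural map `A ⊗ Hom(B, V) → Hom(Hom(A, B), V)`. -/
noncomputable def tensorHomToHomHom : A ⊗[R] (B →ₗ[R] V) →ₗ[R] ((A →ₗ[R] B) →ₗ[R] V) :=
  TensorProduct.lift (LinearMap.mk₂ R (fun a h ↦ h.comp (LinearMap.applyₗ a))
    (fun _ _ _ ↦ by ext; simp) (fun _ _ _ ↦ by ext; simp) (fun _ _ _ ↦ by ext; simp)
    (fun _ _ _ ↦ by ext; simp))

@[simp] lemma tensorHomToHomHom_tmul (a : A) (h : B →ₗ[R] V) (k : A →ₗ[R] B) :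
    tensorHomToHomHom R A B V (a ⊗ₜ h) k = h (k a) := rfl

lemma tensorHomToHomHom_comp_rTensor (k : A →ₗ[R] D) :
    tensorHomToHomHom R D B V ∘ₗ k.rTensor (B →ₗ[R] V) =
      (k.lcomp R B).lcomp R V ∘ₗ tensorHomToHomHom R A B V := by
  ext
  rfl

lemma tensorHomToHomHom_bijective_of_free (n : ℕ) :
    Function.Bijective (tensorHomToHomHom R (Fin n → R) B V) := by
  let χ : (((Fin n → R) →ₗ[R] B) →ₗ[R] V) →ₗ[R] (Fin n → R) ⊗[R] (B →ₗ[R] V) :=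
    ∑ i, (TensorProduct.mk R (Fin n → R) (B →ₗ[R] V) (Pi.single i 1)).comp
      ((LinearMap.smulRightₗ (LinearMap.proj i)).lcomp R V)
  have h1 : χ.comp (tensorHomToHomHom R (Fin n → R) B V) = LinearMap.id := by
    refine TensorProduct.ext' fun a h ↦ ?_
    have (i : Fin n) : ((LinearMap.smulRightₗ (LinearMap.proj i)).lcomp R V)
        (tensorHomToHomHom R (Fin n → R) B V (a ⊗ₜ h)) = a i • h := by
      ext b
      simp
    simp only [χ, LinearMap.comp_apply, LinearMap.sum_apply, this, TensorProduct.mk_apply,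
      LinearMap.id_apply, ← TensorProduct.smul_tmul, ← TensorProduct.sum_tmul]
    congr 1
    ext j
    simp [Pi.single_apply]
  have h2 : (tensorHomToHomHom R (Fin n → R) B V).comp χ = LinearMap.id := by
    refine LinearMap.ext fun u ↦ LinearMap.ext fun k ↦ ?_
    simp only [χ, LinearMap.comp_apply, LinearMap.sum_apply, TensorProduct.mk_apply, map_sum,
      LinearMap.id_apply, tensorHomToHomHom_tmul, LinearMap.lcomp_apply]
    rw [← map_sum]
    congr 1
    ext i
    simp [Pi.single_apply]
  exact ⟨Function.LeftInverse.injective (LinearMap.congr_fun h1),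
    Function.RightInverse.surjective (LinearMap.congr_fun h2)⟩

lemma lcomp_surjective_of_injective [Module.Injective R V] (hf : Function.Injective f) :
    Function.Surjective (f.lcomp R V) := fun u ↦ by
  obtain ⟨w, hw⟩ := Module.Injective.out f hf u
  exact ⟨w, LinearMap.ext hw⟩

lemma tensorHomToHomHom_surjective [Module.Finite R A] [Module.Injective R V] :
    Function.Surjective (tensorHomToHomHom R A B V) := by
  obtain ⟨n, p, hp⟩ := Module.Finite.exists_fin' R A
  have h1 : Function.Surjective
      ((p.lcomp R B).lcomp R V ∘ₗ tensorHomToHomHom R (Fin n → R) B V) :=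
    (lcomp_surjective_of_injective (lcomp_injective_of_surjective hp)).comp
      (tensorHomToHomHom_bijective_of_free n).2
  rw [← tensorHomToHomHom_comp_rTensor, LinearMap.coe_comp] at h1
  exact Function.Surjective.of_comp h1

lemma tensorHomToHomHom_bijective [IsNoetherianRing R] [Module.Finite R A]
    [Module.Injective R V] : Function.Bijective (tensorHomToHomHom R A B V) := by
  refine ⟨(injective_iff_map_eq_zero _).mpr fun x hx ↦ ?_, tensorHomToHomHom_surjective⟩
  obtain ⟨n, p, hK, hp⟩ := exists_finite_free_presentation A (R := R)
  obtain ⟨y, rfl⟩ := LinearMap.rTensor_surjective (B →ₗ[R] V) hp.surj x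
  have hy : (tensorHomToHomHom R (Fin n → R) B V y).comp (p.lcomp R B) = 0 := by
    rw [← hx]
    exact (LinearMap.congr_fun (tensorHomToHomHom_comp_rTensor (B := B) (V := V) p) y).symm
  obtain ⟨w, hw⟩ := exists_comp_eq_of_injective
    (exact_lcomp_of_surjective (V := B) hp.exact hp.surj) _ hy
  obtain ⟨z, rfl⟩ := tensorHomToHomHom_surjective w
  have hz : (LinearMap.ker p).subtype.rTensor (B →ₗ[R] V) z = y := by
    apply (tensorHomToHomHom_bijective_of_free n).1
    rw [← hw]
    exact LinearMap.congr_fun (tensorHomToHomHom_comp_rTensor (B := B) (V := V)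
      (LinearMap.ker p).subtype) z
  rw [← hz, ← LinearMap.comp_apply, ← LinearMap.rTensor_comp,
    hp.exact.linearMap_comp_eq_zero, LinearMap.rTensor_zero, LinearMap.zero_apply]

end FinitelyGenerated

section CharacterDuality

variable {R : Type u} [CommRing R]
variable {A B D V : Type u} [AddCommGroup A] [AddCommGroup B] [AddCommGroup D] [AddCommGroup V]
  [Module R A] [Module R B] [Module R D] [Module R V] {f : A →ₗ[R] B} {g : B →ₗ[R] D}

lemma IsSES.dual (h : IsSES f g) : IsSES (CharacterModule.dual g) (CharacterModule.dual f) where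
  inj := CharacterModule.dual_injective_of_surjective _ h.surj
  exact := CharacterModule.exact_dual_iff.mpr h.exact
  surj := CharacterModule.dual_surjective_of_injective _ h.inj

lemma exists_free_cover (R : Type u) [CommRing R] (A : Type u) [AddCommGroup A] [Module R A] :
    ∃ (P : ModuleCat.{u} R) (p : P →ₗ[R] A), Module.Free R P ∧
      IsSES (LinearMap.ker p).subtype p :=
  ⟨ModuleCat.of R (A →₀ R), Finsupp.linearCombination R id,
    inferInstanceAs (Module.Free R (A →₀ R)),
    Subtype.val_injective, LinearMap.exact_subtype_ker_map _,
    Finsupp.linearCombination_id_surjective R A⟩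

instance [Module.Flat R A] : Module.Injective R (CharacterModule A) :=
  Module.Flat.iff_characterModule_injective.mp inferInstance

lemma extPosVanish_characterModule [Module.Flat R A] : ExtPosVanish R A (CharacterModule B) := by
  intro n
  induction n generalizing B with
  | zero =>
    obtain ⟨P, p, _, hp⟩ := exists_free_cover R B
    refine hp.dual.extVanish_left_of_lift (fun k ↦ ?_) (extPosVanish_of_injective 0)
    obtain ⟨c, hc⟩ := CharacterModule.dual_surjective_of_injective
      ((LinearMap.ker p).subtype.lTensor A)
      (Module.Flat.lTensor_preserves_injective_linearMap _ Subtype.val_injective)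
      (CharacterModule.homEquiv k)
    refine ⟨CharacterModule.homEquiv.symm c, LinearMap.ext fun a ↦ ?_⟩
    ext b
    exact DFunLike.congr_fun hc (a ⊗ₜ b)
  | succ n ih =>
    obtain ⟨P, p, _, hp⟩ := exists_free_cover R B
    exact hp.dual.extVanish_to_left ih (extPosVanish_of_injective _)

variable (R A) in
/-- `Hom(A, R⋆) ≃ A⋆`. -/
noncomputable def homCharacterModuleEquiv :
    (A →ₗ[R] CharacterModule R) ≃ₗ[R] CharacterModule A :=
  CharacterModule.homEquiv.trans (CharacterModule.congr (TensorProduct.rid R A))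

@[simp] lemma homCharacterModuleEquiv_apply (h : A →ₗ[R] CharacterModule R) (a : A) :
    homCharacterModuleEquiv R A h a = h a 1 := rfl

variable (R A B) in
/-- The natural map `A ⊗ B⋆ → Hom(A, B)⋆`. -/
noncomputable def tensorDualToDualHom :
    A ⊗[R] CharacterModule B →ₗ[R] CharacterModule (A →ₗ[R] B) :=
  (homCharacterModuleEquiv R (A →ₗ[R] B)).toLinearMap ∘ₗ
    tensorHomToHomHom R A B (CharacterModule R) ∘ₗ
      (homCharacterModuleEquiv R B).symm.toLinearMap.lTensor A

@[simp] lemma tensorDualToDualHom_tmul (a : A) (c : CharacterModule B) (k : A →ₗ[R] B) :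
    tensorDualToDualHom R A B (a ⊗ₜ c) k = c (k a) := by
  obtain ⟨h, rfl⟩ := (homCharacterModuleEquiv R B).surjective c
  simp [tensorDualToDualHom]

lemma tensorDualToDualHom_comp_rTensor (k : A →ₗ[R] D) :
    tensorDualToDualHom R D B ∘ₗ k.rTensor (CharacterModule B) =
      CharacterModule.dual (k.lcomp R B) ∘ₗ tensorDualToDualHom R A B := by
  refine TensorProduct.ext' fun a c ↦ ?_
  ext l
  change tensorDualToDualHom R D B (k a ⊗ₜ c) l =
    tensorDualToDualHom R A B (a ⊗ₜ c) (l ∘ₗ k)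
  simp

lemma tensorDualToDualHom_bijective [IsNoetherianRing R] [Module.Finite R A] :
    Function.Bijective (tensorDualToDualHom R A B) :=
  (homCharacterModuleEquiv R (A →ₗ[R] B)).bijective.comp
    (tensorHomToHomHom_bijective.comp
      (LinearEquiv.lTensor A (homCharacterModuleEquiv R B).symm).bijective)

lemma flat_characterModule_of_injective [IsNoetherianRing R] [Module.Injective R B] :
    Module.Flat R (CharacterModule B) := by
  rw [Module.Flat.iff_rTensor_injective']
  intro I
  have h1 : Function.Injective
      (tensorDualToDualHom R R B ∘ₗ I.subtype.rTensor (CharacterModule B)) := by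
    rw [tensorDualToDualHom_comp_rTensor]
    exact (CharacterModule.dual_injective_of_surjective _
      (lcomp_surjective_of_injective Subtype.val_injective)).comp tensorDualToDualHom_bijective.1
  rw [LinearMap.coe_comp] at h1
  exact Function.Injective.of_comp h1

variable (R A) in
/-- The evaluation map `A → A⋆⋆`. -/
def evalDualDual : A →ₗ[R] CharacterModule (CharacterModule A) where
  toFun a := AddMonoidHom.eval a
  map_add' _ _ := by
    ext c
    exact map_add c _ _
  map_smul' r a := rfl

lemma evalDualDual_injective : Function.Injective (evalDualDual R A) := fun _ _ h ↦
  CharacterModule.eq_of_forall_apply_eq fun c ↦ DFunLike.congr_fun h c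

lemma isSES_evalDualDual :
    IsSES (evalDualDual R A) (LinearMap.range (evalDualDual R A)).mkQ where
  inj := evalDualDual_injective
  exact := LinearMap.exact_map_mkQ_range _
  surj := Submodule.mkQ_surjective _

lemma flat_of_characterModule_injective (h : Module.Injective R (CharacterModule A)) :
    Module.Flat R A :=
  Module.Flat.iff_characterModule_injective.mpr h

lemma injective_of_retract [Module.Injective R B] (i : A →ₗ[R] B) (r : B →ₗ[R] A)
    (h : r.comp i = LinearMap.id) : Module.Injective R A where
  out X Y _ _ _ _ j hj k := by
    obtain ⟨w, hw⟩ := Module.Injective.out j hj (i.comp k)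
    exact ⟨r.comp w, fun x ↦ by
      rw [LinearMap.comp_apply, hw]
      exact LinearMap.congr_fun h (k x)⟩

lemma flat_cokernel_evalDualDual [IsNoetherianRing R] [Module.Flat R A] :
    Module.Flat R (CharacterModule (CharacterModule A) ⧸ LinearMap.range (evalDualDual R A)) := by
  have := flat_characterModule_of_injective (R := R) (B := CharacterModule A)
  apply flat_of_characterModule_injective
  have hs := (isSES_evalDualDual (R := R) (A := A)).dual
  obtain ⟨r, hr⟩ := exists_comp_eq_of_exact hs.exact hs.inj
    (LinearMap.id - (evalDualDual R (CharacterModule A)).comp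
      (CharacterModule.dual (evalDualDual R A))) (by
        ext c a
        change c (evalDualDual R A a) - c (evalDualDual R A a) = 0
        rw [sub_self])
  refine injective_of_retract (CharacterModule.dual (LinearMap.range (evalDualDual R A)).mkQ) r
    (LinearMap.ext fun c ↦ hs.inj ?_)
  rw [LinearMap.comp_apply, ← LinearMap.comp_apply, hr, LinearMap.sub_apply, LinearMap.comp_apply,
    hs.exact.apply_apply_eq_zero, map_zero, sub_zero]
  rfl

lemma exists_retract_evalDualDual [IsNoetherianRing R] [Module.Flat R A]
    (hA : ∀ F : ModuleCat.{u} R, Module.Flat R F → ExtPosVanish R F A) :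
    ∃ r : CharacterModule (CharacterModule A) →ₗ[R] A,
      r.comp (evalDualDual R A) = LinearMap.id :=
  isSES_evalDualDual.extend_of_extVanish (hA (ModuleCat.of R _) flat_cokernel_evalDualDual 0) _

end CharacterDuality

section Semidualizing

variable {R : Type u} [CommRing R]

/-- Vanishing of `Ext^i(M, Hom(C, I)⋆)` for all `i ≥ 1` and all injective modules `I`. -/
def DualHomPerp (C : ModuleCat.{u} R) (M : Type u) [AddCommGroup M] [Module R M] : Prop :=
  ∀ I : ModuleCat.{u} R, Module.Injective R I →
    ExtPosVanish R M (CharacterModule (↥C →ₗ[R] ↥I))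

variable {C : ModuleCat.{u} R}
variable {A B D F V : Type u} [AddCommGroup A] [AddCommGroup B] [AddCommGroup D] [AddCommGroup F]
  [AddCommGroup V] [Module R A] [Module R B] [Module R D] [Module R F] [Module R V]
  {f : A →ₗ[R] B} {g : B →ₗ[R] D}

lemma DualHomPerp.congr (h : DualHomPerp C A) (e : A ≃ₗ[R] B) : DualHomPerp C B :=
  fun I hI ↦ (h I hI).congr e (LinearEquiv.refl _ _)

lemma dualHomPerp_of_flat [Module.Flat R A] : DualHomPerp C A :=
  fun _ _ ↦ extPosVanish_characterModule

lemma IsSES.lTensor (h : IsSES f g) (F : Type u) [AddCommGroup F] [Module R F]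
    [Module.Flat R F] : IsSES (f.lTensor F) (g.lTensor F) where
  inj := Module.Flat.lTensor_preserves_injective_linearMap _ h.inj
  exact := lTensor_exact F h.exact h.surj
  surj := LinearMap.lTensor_surjective F h.surj

lemma extPosVanish_flat_tensor [IsNoetherianRing R] [Module.Finite R A] [Module.Flat R F]
    (h : ExtPosVanish R A B) : ExtPosVanish R A (F ⊗[R] B) := by
  intro n
  induction n generalizing A with
  | zero =>
    obtain ⟨n, p, hK, hp⟩ := exists_finite_free_presentation A (R := R)
    refine hp.extVanish_right_of_extend (fun k ↦ ?_) (extPosVanish_of_projective 0)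
    obtain ⟨t, rfl⟩ := (lTensorHomToHomLTensor_bijective (R := R)).2 k
    have hs : Function.Surjective ((LinearMap.ker p).subtype.lcomp R B) :=
      fun k ↦ hp.extend_of_extVanish (h 0) k
    obtain ⟨s, rfl⟩ := LinearMap.lTensor_surjective F hs t
    exact ⟨lTensorHomToHomLTensor (RingHom.id R) _ _ _ s,
      (LinearMap.congr_fun (lTensorHomToHomLTensor_comp_lTensor_lcomp
        (LinearMap.ker p).subtype) s).symm⟩
  | succ n ih =>
    obtain ⟨m, p, hK, hp⟩ := exists_finite_free_presentation A (R := R)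
    exact hp.extVanish_from_right (ih fun k ↦
      hp.extVanish_from_left (extPosVanish_of_projective k) (h (k + 1)))
        (extPosVanish_of_projective _)

lemma rTensor_hom_injective [IsNoetherianRing R] [Module.Finite R A] [Module.Finite R B]
    [Module.Injective R V] (hf : Function.Surjective (f.lcomp R D)) :
    Function.Injective (f.rTensor (D →ₗ[R] V)) := by
  have h1 : Function.Injective
      (tensorHomToHomHom R B D V ∘ₗ f.rTensor (D →ₗ[R] V)) := by
    rw [tensorHomToHomHom_comp_rTensor]
    exact (lcomp_injective_of_surjective hf).comp tensorHomToHomHom_bijective.1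
  rw [LinearMap.coe_comp] at h1
  exact Function.Injective.of_comp h1

lemma rTensor_lTensor_injective [Module.Flat R F] (hf : Function.Injective (f.rTensor V)) :
    Function.Injective ((f.lTensor F).rTensor V) := by
  have h : (TensorProduct.assoc R F B V).toLinearMap ∘ₗ (f.lTensor F).rTensor V =
      (f.rTensor V).lTensor F ∘ₗ (TensorProduct.assoc R F A V).toLinearMap := by
    ext
    rfl
  have h1 : Function.Injective
      ((TensorProduct.assoc R F B V).toLinearMap ∘ₗ (f.lTensor F).rTensor V) := by
    rw [h]
    exact (Module.Flat.lTensor_preserves_injective_linearMap _ hf).comp (LinearEquiv.injective _)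
  rw [LinearMap.coe_comp] at h1
  exact Function.Injective.of_comp h1

lemma dualHomPerp_flat_tensor [IsNoetherianRing R] [Module.Finite R A] [Module.Flat R F]
    (h : ExtPosVanish R A C) : DualHomPerp C (F ⊗[R] A) := by
  intro I hI n
  induction n generalizing A with
  | zero =>
    obtain ⟨n, p, hK, hp⟩ := exists_finite_free_presentation A (R := R)
    refine (hp.lTensor F).extVanish_right_of_extend ?_ (extPosVanish_characterModule 0)
    exact rTensor_injective_iff_lcomp_surjective.mp (rTensor_lTensor_injective
      (rTensor_hom_injective fun k ↦ hp.extend_of_extVanish (h 0) k))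
  | succ n ih =>
    obtain ⟨m, p, hK, hp⟩ := exists_finite_free_presentation A (R := R)
    exact (hp.lTensor F).extVanish_from_right (ih fun k ↦
      hp.extVanish_from_left (extPosVanish_of_projective k) (h (k + 1)))
        (extPosVanish_characterModule _)

lemma IsSemidualizing.extPosVanish (hC : IsSemidualizing R C) : ExtPosVanish R C C :=
  (extZero_iff C C).mp hC.2.2

lemma IsSemidualizing.finite (hC : IsSemidualizing R C) : Module.Finite R C := hC.1

lemma IsSemidualizing.mk_bijective [IsNoetherianRing R]
    (hC : IsSemidualizing R C) [Module.Flat R F] :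
    Function.Bijective (TensorProduct.mk R F C) := by
  have := hC.1
  have hs : Function.Bijective (LinearMap.lsmul R C : R →ₗ[R] (↥C →ₗ[R] ↥C)) := hC.2.1
  let e : F ≃ₗ[R] F ⊗[R] (↥C →ₗ[R] ↥C) :=
    (TensorProduct.rid R F).symm.trans (LinearEquiv.lTensor F (LinearEquiv.ofBijective _ hs))
  have : TensorProduct.mk R F C =
      lTensorHomToHomLTensor (RingHom.id R) C F C ∘ₗ e.toLinearMap := by
    ext x c
    simp [e]
  rw [this]
  exact lTensorHomToHomLTensor_bijective.comp e.bijective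

lemma IsSemidualizing.extPosVanish_tensor [IsNoetherianRing R]
    (hC : IsSemidualizing R C) [Module.Flat R F] :
    ExtPosVanish R C (F ⊗[R] C) := by
  have := hC.1
  exact extPosVanish_flat_tensor hC.extPosVanish

lemma IsSemidualizing.dualHomPerp_tensor [IsNoetherianRing R]
    (hC : IsSemidualizing R C) [Module.Flat R F] :
    DualHomPerp C (F ⊗[R] C) := by
  have := hC.1
  exact dualHomPerp_flat_tensor hC.extPosVanish

lemma IsSemidualizing.dualHomPerp_of_isCFlat [IsNoetherianRing R] (hC : IsSemidualizing R C)
    {M : ModuleCat.{u} R} (hM : IsCFlat R C M) : DualHomPerp C M := by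
  obtain ⟨F, _, ⟨e⟩⟩ := hM
  exact hC.dualHomPerp_tensor.congr e.symm

lemma inBassClass_iff (M : ModuleCat.{u} R) : InBassClass R C M ↔ ExtPosVanish R C M ∧
    ExtPosVanish R (↥C →ₗ[R] ↥M) (CharacterModule C) ∧ Function.Bijective (evalMap R C M) := by
  rw [InBassClass, extZero_iff, torZero_iff]

lemma evalMap_naturality {M N : ModuleCat.{u} R} (k : ↥M →ₗ[R] ↥N) :
    evalMap R C N ∘ₗ (LinearMap.llcomp R C M N k).lTensor C = k ∘ₗ evalMap R C M := by
  refine TensorProduct.ext' fun c l ↦ ?_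
  rfl

lemma InBassClass.congr {M N : ModuleCat.{u} R} (h : InBassClass R C M) (e : M ≃ₗ[R] N) :
    InBassClass R C N := by
  rw [inBassClass_iff] at h ⊢
  obtain ⟨h1, h2, h3⟩ := h
  refine ⟨h1.congr (LinearEquiv.refl _ _) e,
    h2.congr (e.congrRight) (LinearEquiv.refl _ _), ?_⟩
  let e' := LinearEquiv.lTensor C (e.congrRight (M := C))
  have : evalMap R C N ∘ₗ e'.toLinearMap = e.toLinearMap ∘ₗ evalMap R C M :=
    evalMap_naturality e.toLinearMap
  have h4 : Function.Bijective (evalMap R C N ∘ e') := by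
    rw [← LinearEquiv.coe_toLinearMap, ← LinearMap.coe_comp, this]
    exact e.bijective.comp h3
  exact (Function.Bijective.of_comp_iff _ e'.bijective).mp h4

lemma inBassClass_tensor {N : Type u} [AddCommGroup N] [Module R N]
    (h1 : ExtPosVanish R C (N ⊗[R] C)) (h2 : ExtPosVanish R N (CharacterModule C))
    (h3 : Function.Bijective (TensorProduct.mk R N C)) :
    InBassClass R C (ModuleCat.of R (N ⊗[R] C)) := by
  rw [inBassClass_iff]
  let e := LinearEquiv.ofBijective _ h3
  refine ⟨h1, h2.congr e (LinearEquiv.refl _ _), ?_⟩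
  have h4 : Function.Bijective
      (evalMap R C (ModuleCat.of R (N ⊗[R] C)) ∘ LinearEquiv.lTensor C e) := by
    have : evalMap R C (ModuleCat.of R (N ⊗[R] C)) ∘ₗ (LinearEquiv.lTensor C e).toLinearMap =
        (TensorProduct.comm R C N).toLinearMap := by
      refine TensorProduct.ext' fun c l ↦ ?_
      rfl
    rw [← LinearEquiv.coe_toLinearMap, ← LinearMap.coe_comp, this]
    exact (TensorProduct.comm R C N).bijective
  exact (Function.Bijective.of_comp_iff _ (LinearEquiv.lTensor C e).bijective).mp h4

lemma IsSemidualizing.inBassClass_of_isCFlat [IsNoetherianRing R] (hC : IsSemidualizing R C)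
    {M : ModuleCat.{u} R} (hM : IsCFlat R C M) : InBassClass R C M := by
  obtain ⟨F, _, ⟨e⟩⟩ := hM
  exact (inBassClass_tensor hC.extPosVanish_tensor extPosVanish_characterModule
    hC.mk_bijective).congr e.symm

lemma isCFlatCotorsion_dual_hom [IsNoetherianRing R] [Module.Finite R C] {I : ModuleCat.{u} R}
    [Module.Injective R I] :
    IsCFlatCotorsion R C (ModuleCat.of R (CharacterModule (↥C →ₗ[R] ↥I))) :=
  ⟨ModuleCat.of R (CharacterModule I), flat_characterModule_of_injective,
    fun _ _ ↦ (extZero_iff _ _).mpr extPosVanish_characterModule,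
    ⟨(LinearEquiv.ofBijective _ tensorDualToDualHom_bijective).symm.trans
      (TensorProduct.comm R _ _)⟩⟩

lemma extend_of_isCFlatCotorsion [IsNoetherianRing R] [Module.Finite R C]
    (h : ∀ I : ModuleCat.{u} R, Module.Injective R I →
      Function.Surjective (f.lcomp R (CharacterModule (↥C →ₗ[R] ↥I))))
    {N : ModuleCat.{u} R} (hN : IsCFlatCotorsion R C N) : Function.Surjective (f.lcomp R N) := by
  obtain ⟨F, _, hF, ⟨e⟩⟩ := hN
  obtain ⟨r, hr⟩ := exists_retract_evalDualDual (R := R) (A := F)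
    fun G hG ↦ (extZero_iff G F).mp (hF G hG)
  let w : CharacterModule (CharacterModule F) ⊗[R] C ≃ₗ[R] CharacterModule
      (↥C →ₗ[R] ↥(ModuleCat.of R (CharacterModule F))) :=
    (TensorProduct.comm R _ _).trans (LinearEquiv.ofBijective _ tensorDualToDualHom_bijective)
  intro k
  obtain ⟨l, hl⟩ := h (ModuleCat.of R (CharacterModule F)) inferInstance
    (w.toLinearMap ∘ₗ (evalDualDual R F).rTensor C ∘ₗ e.toLinearMap ∘ₗ k)
  refine ⟨e.symm.toLinearMap ∘ₗ r.rTensor C ∘ₗ w.symm.toLinearMap ∘ₗ l, LinearMap.ext fun a ↦ ?_⟩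
  have hla : l (f a) = w ((evalDualDual R F).rTensor C (e (k a))) := LinearMap.congr_fun hl a
  change e.symm (r.rTensor C (w.symm (l (f a)))) = k a
  rw [hla, LinearEquiv.symm_apply_apply, ← LinearMap.comp_apply (r.rTensor C),
    ← LinearMap.rTensor_comp, hr]
  simp

end Semidualizing

section Syzygies

lemma exists_int_family {α : Type*} (Rel : ℤ → α → α → Prop) (SL SR : α → Prop) (M : α)
    (hL : SL M) (hR : SR M)
    (stepL : ∀ i : ℤ, 0 ≤ i → ∀ B, SL B → ∃ A, SL A ∧ Rel i A B)
    (stepR : ∀ i : ℤ, i < 0 → ∀ A, SR A → ∃ B, SR B ∧ Rel i A B) :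
    ∃ K : ℤ → α, K 0 = M ∧ ∀ i, Rel i (K (i + 1)) (K i) := by
  choose! l hl using stepL
  choose! r hr using stepR
  let L : ℕ → α := fun n ↦ Nat.rec M (fun n B ↦ l n B) n
  let S : ℕ → α := fun n ↦ Nat.rec M (fun n A ↦ r (Int.negSucc n) A) n
  have hSL : ∀ n, SL (L n) := fun n ↦ by
    induction n with
    | zero => exact hL
    | succ n ih => exact (hl n (by omega) _ ih).1
  have hSR : ∀ n, SR (S n) := fun n ↦ by
    induction n with
    | zero => exact hR
    | succ n ih => exact (hr (Int.negSucc n) (by omega) _ ih).1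
  refine ⟨fun i ↦ Int.rec (fun n ↦ L n) (fun n ↦ S (n + 1)) i, rfl, fun i ↦ ?_⟩
  match i with
  | Int.ofNat n => exact (hl n (by omega) _ (hSL n)).2
  | Int.negSucc 0 => exact (hr (Int.negSucc 0) (by omega) _ (hSR 0)).2
  | Int.negSucc (n + 1) => exact (hr (Int.negSucc (n + 1)) (by omega) _ (hSR (n + 1))).2

/-- A sequence of short exact sequences `0 → K (i + 1) → X i → K i → 0`. -/
structure SyzygySequence (R : Type u) [CommRing R] where
  X : ℤ → ModuleCat.{u} R
  K : ℤ → ModuleCat.{u} R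
  ι : ∀ i : ℤ, ↥(K (i + 1)) →ₗ[R] ↥(X i)
  π : ∀ i : ℤ, ↥(X i) →ₗ[R] ↥(K i)
  isSES : ∀ i : ℤ, IsSES (ι i) (π i)

variable {R : Type u} [CommRing R]

namespace SyzygySequence

variable (S : SyzygySequence R)

lemma exists_of_step
    (SL SR : ModuleCat.{u} R → Prop) (Q : ∀ (_ : ℤ) (A X B : ModuleCat.{u} R),
      (↥A →ₗ[R] ↥X) → (↥X →ₗ[R] ↥B) → Prop) (M : ModuleCat.{u} R)
    (hL : SL M) (hR : SR M)
    (stepL : ∀ i : ℤ, 0 ≤ i → ∀ B, SL B → ∃ (A X : ModuleCat.{u} R) (f : ↥A →ₗ[R] ↥X)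
      (g : ↥X →ₗ[R] ↥B), SL A ∧ IsSES f g ∧ Q i A X B f g)
    (stepR : ∀ i : ℤ, i < 0 → ∀ A, SR A → ∃ (B X : ModuleCat.{u} R) (f : ↥A →ₗ[R] ↥X)
      (g : ↥X →ₗ[R] ↥B), SR B ∧ IsSES f g ∧ Q i A X B f g) :
    ∃ S : SyzygySequence R, S.K 0 = M ∧ ∀ i, Q i _ _ _ (S.ι i) (S.π i) := by
  obtain ⟨K, hK, h⟩ := exists_int_family (fun (i : ℤ) (A B : ModuleCat.{u} R) ↦
    ∃ (X : ModuleCat.{u} R) (f : ↥A →ₗ[R] ↥X)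
      (g : ↥X →ₗ[R] ↥B), IsSES f g ∧ Q i A X B f g) SL SR M hL hR
    (fun i hi B hB ↦ by
      obtain ⟨A, X, f, g, h1, h2⟩ := stepL i hi B hB
      exact ⟨A, h1, X, f, g, h2⟩)
    (fun i hi A hA ↦ by
      obtain ⟨B, X, f, g, h1, h2⟩ := stepR i hi A hA
      exact ⟨B, h1, X, f, g, h2⟩)
  choose X f g h1 h2 using h
  exact ⟨⟨X, K, f, g, h1⟩, hK, h2⟩

/-- The spliced complex. -/
def toZComplex : ZComplex R where
  X := S.X
  d i := (S.ι i).comp (S.π (i + 1))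
  d_comp_d i := by
    ext x
    simp [(S.isSES (i + 1)).exact.apply_apply_eq_zero]

lemma toZComplex_isExact : S.toZComplex.IsExact := by
  intro i x
  change S.ι i (S.π (i + 1) x) = 0 ↔ _
  rw [map_eq_zero_iff _ (S.isSES i).inj, (S.isSES (i + 1)).exact x]
  constructor
  · rintro ⟨y, rfl⟩
    obtain ⟨z, rfl⟩ := (S.isSES (i + 1 + 1)).surj y
    exact ⟨z, rfl⟩
  · rintro ⟨z, rfl⟩
    exact ⟨_, rfl⟩

lemma toZComplex_isCoker : S.toZComplex.IsCokerOfD1 (S.K 0) := by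
  have h : LinearMap.range ((S.ι 0).comp (S.π (0 + 1))) = LinearMap.ker (S.π 0) := by
    rw [(S.isSES 0).exact.linearMap_ker_eq]
    exact LinearMap.range_comp_of_range_eq_top _ (LinearMap.range_eq_top.mpr (S.isSES (0 + 1)).surj)
  change Nonempty (S.K 0 ≃ₗ[R] (S.X 0 ⧸ LinearMap.range ((S.ι 0).comp (S.π (0 + 1)))))
  exact ⟨((Submodule.quotEquivOfEq _ _ h).trans
    ((S.π 0).quotKerEquivOfSurjective (S.isSES 0).surj)).symm⟩

lemma toZComplex_homFromExact {V : ModuleCat.{u} R}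
    (h : ∀ (i : ℤ) (k : ↥V →ₗ[R] ↥(S.K i)), ∃ l : ↥V →ₗ[R] ↥(S.X i), (S.π i).comp l = k) :
    S.toZComplex.HomFromExact V := by
  intro i k
  constructor
  · intro hk
    change (S.ι i).comp ((S.π (i + 1)).comp k) = 0 at hk
    obtain ⟨w, hw⟩ := exists_comp_eq_of_exact (S.isSES (i + 1)).exact (S.isSES (i + 1)).inj k
      (LinearMap.ext fun x ↦ (S.isSES i).inj (by
        simpa using LinearMap.congr_fun hk x))
    obtain ⟨l, hl⟩ := h (i + 1 + 1) w
    refine ⟨l, ?_⟩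
    change (S.ι (i + 1)).comp ((S.π (i + 1 + 1)).comp l) = k
    rw [hl, hw]
  · rintro ⟨l, rfl⟩
    change (S.toZComplex.d i).comp ((S.toZComplex.d (i + 1)).comp l) = 0
    rw [← LinearMap.comp_assoc, S.toZComplex.d_comp_d, LinearMap.zero_comp]

lemma toZComplex_homToExact {V : ModuleCat.{u} R}
    (h : ∀ i : ℤ, Function.Surjective ((S.ι i).lcomp R V)) :
    S.toZComplex.HomToExact V := by
  intro i k
  constructor
  · intro hk
    change (k.comp (S.ι (i + 1))).comp (S.π (i + 1 + 1)) = 0 at hk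
    obtain ⟨w, hw⟩ := exists_comp_eq_of_exact_of_surjective (S.isSES (i + 1)).exact
      (S.isSES (i + 1)).surj k (LinearMap.ext fun x ↦ by
        obtain ⟨y, rfl⟩ := (S.isSES (i + 1 + 1)).surj x
        exact LinearMap.congr_fun hk y)
    obtain ⟨l, hl⟩ := h i w
    refine ⟨l, ?_⟩
    change (l.comp (S.ι i)).comp (S.π (i + 1)) = k
    rw [← hw, ← hl]
    rfl
  · rintro ⟨l, rfl⟩
    change (l.comp (S.toZComplex.d i)).comp (S.toZComplex.d (i + 1)) = 0
    rw [LinearMap.comp_assoc, S.toZComplex.d_comp_d, LinearMap.comp_zero]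

end SyzygySequence

namespace ZComplex

variable (Z : ZComplex R)

/-- The decomposition of an exact complex into short exact sequences. -/
def toSyzygySequence (h : Z.IsExact) : SyzygySequence R where
  X := Z.X
  K i := ModuleCat.of R (Z.X i ⧸ LinearMap.range (Z.d i))
  ι i := (LinearMap.range (Z.d (i + 1))).liftQ (Z.d i)
    (LinearMap.range_le_ker_iff.mpr (Z.d_comp_d i))
  π i := (LinearMap.range (Z.d i)).mkQ
  isSES i :=
    { inj := LinearMap.ker_eq_bot.mp
        (Submodule.ker_liftQ_eq_bot _ _ _ (h i).linearMap_ker_eq.le)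
      exact := LinearMap.exact_iff.mpr (by rw [Submodule.ker_mkQ, Submodule.range_liftQ])
      surj := Submodule.mkQ_surjective _ }

variable {Z}

lemma exists_lift_of_homFromExact (h : Z.IsExact) {V : ModuleCat.{u} R} (hV : Z.HomFromExact V)
    (i : ℤ) (k : ↥V →ₗ[R] ↥((Z.toSyzygySequence h).K i)) :
    ∃ l : ↥V →ₗ[R] ↥(Z.X i), ((Z.toSyzygySequence h).π i).comp l = k := by
  obtain ⟨j, rfl⟩ : ∃ j, i = j + 1 + 1 := ⟨i - 1 - 1, by ring⟩
  let S := Z.toSyzygySequence h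
  obtain ⟨l, hl⟩ := (hV j ((S.ι (j + 1)).comp k)).mp (by
    refine LinearMap.ext fun x ↦ ?_
    change S.ι j (S.π (j + 1) (S.ι (j + 1) (k x))) = 0
    rw [(S.isSES (j + 1)).exact.apply_apply_eq_zero, map_zero])
  exact ⟨l, LinearMap.ext fun x ↦ (S.isSES (j + 1)).inj (LinearMap.congr_fun hl x)⟩

lemma lcomp_surjective_of_homToExact (h : Z.IsExact) {V : ModuleCat.{u} R} (hV : Z.HomToExact V)
    (i : ℤ) : Function.Surjective (((Z.toSyzygySequence h).ι i).lcomp R V) := by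
  intro k
  let S := Z.toSyzygySequence h
  obtain ⟨l, hl⟩ := (hV i (k.comp (S.π (i + 1)))).mp (by
    refine LinearMap.ext fun x ↦ ?_
    change k (S.π (i + 1) (S.ι (i + 1) (S.π (i + 1 + 1) x))) = 0
    rw [(S.isSES (i + 1)).exact.apply_apply_eq_zero, map_zero])
  refine ⟨l, LinearMap.ext fun x ↦ ?_⟩
  obtain ⟨y, rfl⟩ := (S.isSES (i + 1)).surj x
  exact LinearMap.congr_fun hl y

lemma tensorExact_iff_homToExact (J : ModuleCat.{u} R) :
    Z.TensorExact J ↔ Z.HomToExact (ModuleCat.of R (CharacterModule J)) :=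
  forall_congr' fun _ ↦ (exact_lcomp_characterModule_iff (R := R) J).symm

end ZComplex

end Syzygies

section Coresolutions

variable {R : Type u} [CommRing R] {C : ModuleCat.{u} R}

namespace DualHomPerp

variable {A B D : Type u} [AddCommGroup A] [AddCommGroup B] [AddCommGroup D]
  [Module R A] [Module R B] [Module R D] {f : A →ₗ[R] B} {g : B →ₗ[R] D}

lemma left (h : IsSES f g) (hB : DualHomPerp C B) (hD : DualHomPerp C D) : DualHomPerp C A :=
  fun I hI n ↦ h.extVanish_from_left (hB I hI n) (hD I hI (n + 1))

lemma middle (h : IsSES f g) (hA : DualHomPerp C A) (hD : DualHomPerp C D) : DualHomPerp C B :=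
  fun I hI n ↦ h.extVanish_from_middle (hA I hI n) (hD I hI n)

lemma lcomp_surjective (h : IsSES f g) (hD : DualHomPerp C D) (I : ModuleCat.{u} R)
    (hI : Module.Injective R I) :
    Function.Surjective (f.lcomp R (CharacterModule (↥C →ₗ[R] ↥I))) :=
  fun k ↦ h.extend_of_extVanish (hD I hI 0) k

end DualHomPerp

/-- `M` has a coresolution by modules in `𝒳` all of whose cosyzygies satisfy `DualHomPerp C`. -/
def HasPerpCoresolution (C : ModuleCat.{u} R) (𝒳 : ModuleCat.{u} R → Prop) (M : ModuleCat.{u} R) :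
    Prop :=
  ∃ 𝒮 : ModuleCat.{u} R → Prop, 𝒮 M ∧ ∀ S, 𝒮 S → ∃ (X S' : ModuleCat.{u} R) (f : ↥S →ₗ[R] ↥X)
    (g : ↥X →ₗ[R] ↥S'), IsSES f g ∧ 𝒳 X ∧ DualHomPerp C S' ∧ 𝒮 S'

namespace SyzygySequence

variable (S : SyzygySequence R)

lemma dualHomPerp (hX : ∀ i, DualHomPerp C (S.X i))
    (h : ∀ (i : ℤ) (I : ModuleCat.{u} R), Module.Injective R I →
      Function.Surjective ((S.ι i).lcomp R (CharacterModule (↥C →ₗ[R] ↥I)))) (i : ℤ) :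
    DualHomPerp C (S.K i) := by
  intro I hI n
  induction n generalizing i with
  | zero => exact (S.isSES i).extVanish_right_of_extend (h i I hI) (hX i I hI 0)
  | succ n ih => exact (S.isSES i).extVanish_from_right (ih (i + 1)) (hX i I hI (n + 1))

lemma hasPerpCoresolution (hK : ∀ i, DualHomPerp C (S.K i)) {𝒳 : ModuleCat.{u} R → Prop}
    (hX : ∀ i < 0, 𝒳 (S.X i)) {M : ModuleCat.{u} R} (e : M ≃ₗ[R] S.K 0) :
    HasPerpCoresolution C 𝒳 M := by
  refine ⟨fun T ↦ ∃ i ≤ 0, Nonempty (T ≃ₗ[R] S.K i), ⟨0, le_rfl, ⟨e⟩⟩, ?_⟩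
  rintro T ⟨i, hi, ⟨e⟩⟩
  obtain ⟨j, rfl⟩ : ∃ j, i = j + 1 := ⟨i - 1, by ring⟩
  refine ⟨S.X j, S.K j, S.ι j ∘ₗ e.toLinearMap, S.π j, ⟨?_, ?_, (S.isSES j).surj⟩,
    hX j (by omega), hK j, j, by omega, ⟨LinearEquiv.refl _ _⟩⟩
  · exact (S.isSES j).inj.comp e.injective
  · intro x
    rw [(S.isSES j).exact x]
    exact (e.surjective.exists (p := fun y ↦ S.ι j y = x))

end SyzygySequence

lemma IsSemidualizing.isGCFlat_iff [IsNoetherianRing R] (hC : IsSemidualizing R C)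
    (M : ModuleCat.{u} R) :
    IsGCFlat R C M ↔ DualHomPerp C M ∧ HasPerpCoresolution C (IsCFlat R C) M := by
  constructor
  · rintro ⟨Z, hZ, hflat, hCflat, ht, ⟨e⟩⟩
    let S := Z.toSyzygySequence hZ
    have hK : ∀ i, DualHomPerp C (S.K i) := by
      refine S.dualHomPerp (fun i ↦ ?_) (fun i I hI ↦ ?_)
      · rcases le_or_gt 0 i with hi | hi
        · have := hflat i hi
          change DualHomPerp C (Z.X i)
          exact dualHomPerp_of_flat
        · exact hC.dualHomPerp_of_isCFlat (hCflat i hi)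
      · exact ZComplex.lcomp_surjective_of_homToExact hZ ((Z.tensorExact_iff_homToExact
          (ModuleCat.of R (↥C →ₗ[R] ↥I))).mp (ht _ ⟨I, hI, ⟨LinearEquiv.refl _ _⟩⟩)) i
    exact ⟨(hK 0).congr e.symm, S.hasPerpCoresolution hK hCflat e⟩
  · rintro ⟨hM, 𝒮, h𝒮M, h𝒮⟩
    obtain ⟨S, hS0, hS⟩ := SyzygySequence.exists_of_step (fun B ↦ DualHomPerp C B) 𝒮
      (fun i _ X B _ _ ↦ (0 ≤ i → Module.Flat R X) ∧ (i < 0 → IsCFlat R C X) ∧ DualHomPerp C B)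
      M hM h𝒮M
      (fun i hi B hB ↦ by
        obtain ⟨P, p, _, hp⟩ := exists_free_cover R B
        exact ⟨ModuleCat.of R (LinearMap.ker p), P, _, _, .left hp dualHomPerp_of_flat hB, hp,
          fun _ ↦ inferInstance, fun h ↦ absurd h (by omega), hB⟩)
      (fun i hi A hA ↦ by
        obtain ⟨X, B, f, g, h, hX, hB, hSB⟩ := h𝒮 A hA
        exact ⟨B, X, f, g, hSB, h, fun h ↦ absurd h (by omega), fun _ ↦ hX, hB⟩)
    subst hS0
    refine ⟨S.toZComplex, S.toZComplex_isExact, fun i ↦ (hS i).1, fun i ↦ (hS i).2.1, ?_,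
      S.toZComplex_isCoker⟩
    rintro J ⟨I, hI, ⟨e⟩⟩
    rw [ZComplex.tensorExact_iff_homToExact]
    refine S.toZComplex_homToExact fun i k ↦ (S.isSES i).extend_of_extVanish ?_ k
    exact ((hS i).2.2 I hI 0).congr (LinearEquiv.refl _ _) (CharacterModule.congr e.symm)

end Coresolutions

section BassClass

variable {R : Type u} [CommRing R] {C : ModuleCat.{u} R}

lemma IsSES.llcomp_exact {A B D : Type u} [AddCommGroup A] [AddCommGroup B] [AddCommGroup D]
    [Module R A] [Module R B] [Module R D] {f : A →ₗ[R] B} {g : B →ₗ[R] D} (h : IsSES f g)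
    {V : Type u} [AddCommGroup V] [Module R V]
    (hl : ∀ k : V →ₗ[R] D, ∃ l : V →ₗ[R] B, g ∘ₗ l = k) :
    IsSES (A := V →ₗ[R] A) (B := V →ₗ[R] B) (D := V →ₗ[R] D) (LinearMap.llcomp R V A B f)
      (LinearMap.llcomp R V B D g) where
  inj k k' hk := LinearMap.ext fun x ↦ h.inj (LinearMap.congr_fun hk x)
  exact k := by
    constructor
    · exact fun hk ↦ exists_comp_eq_of_exact h.exact h.inj k hk
    · rintro ⟨l, rfl⟩
      exact LinearMap.ext fun x ↦ h.exact.apply_apply_eq_zero (l x)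
  surj := hl

lemma SyzygySequence.inBassClass (S : SyzygySequence R) (hX : ∀ i, InBassClass R C (S.X i))
    (hl : ∀ (i : ℤ) (k : ↥C →ₗ[R] ↥(S.K i)), ∃ l : ↥C →ₗ[R] ↥(S.X i), (S.π i).comp l = k) (i : ℤ) :
    InBassClass R C (S.K i) := by
  simp only [inBassClass_iff] at hX ⊢
  have hs (i : ℤ) := (S.isSES i).llcomp_exact (hl i)
  have hsurj (i : ℤ) : Function.Surjective (evalMap R C (S.K i)) := fun x ↦ by
    obtain ⟨y, rfl⟩ := (S.isSES i).surj x
    obtain ⟨z, rfl⟩ := (hX i).2.2.2 y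
    exact ⟨_, LinearMap.congr_fun (evalMap_naturality (C := C) (S.π i)) z⟩
  have hinj (i : ℤ) : Function.Injective (evalMap R C (S.K i)) := by
    rw [injective_iff_map_eq_zero]
    intro x hx
    obtain ⟨y, rfl⟩ := LinearMap.lTensor_surjective C (hs i).surj x
    have h1 : S.π i (evalMap R C (S.X i) y) = 0 :=
      (LinearMap.congr_fun (evalMap_naturality (C := C) (S.π i)) y).symm.trans hx
    obtain ⟨z, hz⟩ := ((S.isSES i).exact _).mp h1
    obtain ⟨w, rfl⟩ := hsurj (i + 1) z
    have h2 := (LinearMap.congr_fun (evalMap_naturality (C := C) (S.ι i)) w).trans hz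
    have h3 := (hX i).2.2.1 h2
    rw [← h3]
    exact (lTensor_exact C (hs i).exact (hs i).surj).apply_apply_eq_zero w
  have htensor (i : ℤ) : Function.Injective
      (LinearMap.lTensor (N := ↥C →ₗ[R] ↥(S.K (i + 1))) (P := ↥C →ₗ[R] ↥(S.X i)) C
        (LinearMap.llcomp R C (S.K (i + 1)) (S.X i) (S.ι i))) := by
    have h1 : Function.Injective (S.ι i ∘ₗ evalMap R C (S.K (i + 1))) :=
      (S.isSES i).inj.comp (hinj (i + 1))
    rw [← evalMap_naturality, LinearMap.coe_comp] at h1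
    exact Function.Injective.of_comp h1
  refine ⟨fun n ↦ ?_, fun n ↦ ?_, hinj i, hsurj i⟩
  · induction n generalizing i with
    | zero =>
      obtain ⟨j, rfl⟩ : ∃ j, i = j + 1 := ⟨i - 1, by ring⟩
      exact (S.isSES j).extVanish_left_of_lift (hl j) ((hX j).1 0)
    | succ n ih =>
      obtain ⟨j, rfl⟩ : ∃ j, i = j + 1 := ⟨i - 1, by ring⟩
      exact (S.isSES j).extVanish_to_left (ih j) ((hX j).1 (n + 1))
  · induction n generalizing i with
    | zero =>
      exact (hs i).extVanish_right_of_extend (rTensor_injective_iff_lcomp_surjective.mp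
        (LinearMap.lTensor_inj_iff_rTensor_inj _ _ |>.mp (htensor i))) ((hX i).2.1 0)
    | succ n ih => exact (hs i).extVanish_from_right (ih (i + 1)) ((hX i).2.1 (n + 1))

lemma IsSemidualizing.of_hClass [IsNoetherianRing R] (hC : IsSemidualizing R C)
    {𝒳 : ModuleCat.{u} R → Prop} (h𝒳 : ∀ X, 𝒳 X → InBassClass R C X ∧ DualHomPerp C X)
    {M : ModuleCat.{u} R} (hM : HClass R C 𝒳 M) :
    InBassClass R C M ∧ DualHomPerp C M ∧ HasPerpCoresolution C 𝒳 M := by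
  have := hC.finite
  obtain ⟨Z, hZ, hX, hfrom, hto, ⟨e⟩⟩ := hM
  let S := Z.toSyzygySequence hZ
  have hK : ∀ i, DualHomPerp C (S.K i) :=
    S.dualHomPerp (fun i ↦ (h𝒳 _ (hX i)).2) fun i I hI ↦
      ZComplex.lcomp_surjective_of_homToExact hZ (hto _ isCFlatCotorsion_dual_hom) i
  have hB := S.inBassClass (C := C) (fun i ↦ (h𝒳 _ (hX i)).1) (fun i k ↦ by
    obtain ⟨l, hl⟩ := ZComplex.exists_lift_of_homFromExact hZ
      (hfrom (ModuleCat.of R R) (inferInstanceAs (Module.Projective R R))) i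
      (k ∘ₗ (TensorProduct.lid R C).toLinearMap)
    refine ⟨l ∘ₗ (TensorProduct.lid R C).symm.toLinearMap, ?_⟩
    refine LinearMap.ext fun c ↦ (LinearMap.congr_fun hl ((1 : R) ⊗ₜ[R] c)).trans ?_
    simp)
  exact ⟨(hB 0).congr e.symm, (hK 0).congr e.symm, S.hasPerpCoresolution hK (fun i _ ↦ hX i) e⟩

/-- Modules `N` such that `N ⊗ C` lies in the Bass class, together with `DualHomPerp C (N ⊗ C)`. -/
structure IsAuslanderPerp (C : ModuleCat.{u} R) (N : Type u) [AddCommGroup N] [Module R N] :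
    Prop where
  ext_tensor : ExtPosVanish R C (N ⊗[R] C)
  ext_dual : ExtPosVanish R N (CharacterModule C)
  mk_bijective : Function.Bijective (TensorProduct.mk R N C)
  dualHomPerp : DualHomPerp C (N ⊗[R] C)

lemma InBassClass.isAuslanderPerp {M : ModuleCat.{u} R} (hM : InBassClass R C M)
    (hM' : DualHomPerp C M) : Nonempty (M ≃ₗ[R] (↥C →ₗ[R] ↥M) ⊗[R] C) ∧
      IsAuslanderPerp C (↥C →ₗ[R] ↥M) := by
  rw [inBassClass_iff] at hM
  let e := LinearEquiv.ofBijective _ hM.2.2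
  let e' := e.symm.trans (TensorProduct.comm R C (↥C →ₗ[R] ↥M))
  refine ⟨⟨e'⟩, hM.1.congr (LinearEquiv.refl _ _) e', hM.2.1, ?_, hM'.congr e'⟩
  have h : TensorProduct.mk R (↥C →ₗ[R] ↥M) C = e'.congrRight.toLinearMap := by
    ext k c
    change k ⊗ₜ[R] c = TensorProduct.comm R C (↥C →ₗ[R] ↥M) (e.symm (k c))
    have : k c = e (c ⊗ₜ k) := rfl
    rw [this, LinearEquiv.symm_apply_apply, TensorProduct.comm_tmul]
  rw [h]
  exact e'.congrRight.bijective

lemma IsAuslanderPerp.isSES_rTensor {A B D : Type u} [AddCommGroup A] [AddCommGroup B]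
    [AddCommGroup D] [Module R A] [Module R B] [Module R D] {f : A →ₗ[R] B} {g : B →ₗ[R] D}
    (h : IsSES f g) (hD : IsAuslanderPerp C D) : IsSES (f.rTensor C) (g.rTensor C) where
  inj := rTensor_injective_iff_lcomp_surjective.mpr
    fun k ↦ h.extend_of_extVanish (hD.ext_dual 0) k
  exact := rTensor_exact C h.exact h.surj
  surj := LinearMap.rTensor_surjective C h.surj

lemma IsAuslanderPerp.left [IsNoetherianRing R] (hC : IsSemidualizing R C) {A B D : Type u}
    [AddCommGroup A] [AddCommGroup B] [AddCommGroup D] [Module R A] [Module R B] [Module R D]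
    {f : A →ₗ[R] B} {g : B →ₗ[R] D} (h : IsSES f g) [Module.Flat R B]
    (hD : IsAuslanderPerp C D) : IsAuslanderPerp C A := by
  have h' := hD.isSES_rTensor h
  have hB := hC.mk_bijective (F := B)
  refine ⟨fun n ↦ ?_, fun n ↦ h.extVanish_from_left (extPosVanish_characterModule n)
    (hD.ext_dual (n + 1)), ⟨fun x y hxy ↦ ?_, fun k ↦ ?_⟩, .left h' hC.dualHomPerp_tensor
    hD.dualHomPerp⟩
  · cases n with
    | zero =>
      refine h'.extVanish_left_of_lift (fun k ↦ ?_) (hC.extPosVanish_tensor 0)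
      obtain ⟨x, rfl⟩ := hD.mk_bijective.2 k
      obtain ⟨y, rfl⟩ := h.surj x
      exact ⟨TensorProduct.mk R B C y, rfl⟩
    | succ n => exact h'.extVanish_to_left (hD.ext_tensor n) (hC.extPosVanish_tensor (n + 1))
  · exact h.inj (hB.1 (LinearMap.ext fun c ↦
      congrArg (f.rTensor C) (LinearMap.congr_fun hxy c)))
  · obtain ⟨y, hy⟩ := hB.2 (f.rTensor C ∘ₗ k)
    have hy0 : g y = 0 := hD.mk_bijective.1 (LinearMap.ext fun c ↦ by
      have h1 : g.rTensor C (TensorProduct.mk R B C y c) = g.rTensor C (f.rTensor C (k c)) :=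
        congrArg _ (LinearMap.congr_fun hy c)
      rw [h'.exact.apply_apply_eq_zero] at h1
      rw [map_zero, LinearMap.zero_apply]
      exact h1)
    obtain ⟨x, rfl⟩ := (h.exact y).mp hy0
    exact ⟨x, LinearMap.ext fun c ↦ h'.inj (LinearMap.congr_fun hy c)⟩

lemma IsSemidualizing.hClass_isCFlat [IsNoetherianRing R] (hC : IsSemidualizing R C)
    {M : ModuleCat.{u} R} (hM : InBassClass R C M) (hM' : DualHomPerp C M)
    (h : HasPerpCoresolution C (IsCFlat R C) M) : HClass R C (IsCFlat R C) M := by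
  have := hC.finite
  obtain ⟨𝒮, h𝒮M, h𝒮⟩ := h
  obtain ⟨S, hS0, hS⟩ := SyzygySequence.exists_of_step
    (fun B ↦ ∃ N : ModuleCat.{u} R, Nonempty (B ≃ₗ[R] N ⊗[R] C) ∧ IsAuslanderPerp C N)
    (fun A ↦ ExtPosVanish R C A ∧ 𝒮 A)
    (fun _ A X B _ _ ↦ IsCFlat R C X ∧ DualHomPerp C B ∧ ExtVanish R C A 1)
    M ⟨ModuleCat.of R (↥C →ₗ[R] ↥M), hM.isAuslanderPerp hM'⟩
    ⟨((inBassClass_iff M).mp hM).1, h𝒮M⟩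
    (fun i hi B hB ↦ by
      obtain ⟨N, ⟨e⟩, hN⟩ := hB
      obtain ⟨P, p, _, hp⟩ := exists_free_cover R N
      have hA := hN.left hC hp
      have h' := hN.isSES_rTensor hp
      refine ⟨ModuleCat.of R (LinearMap.ker p ⊗[R] C), ModuleCat.of R (P ⊗[R] C),
        (LinearMap.ker p).subtype.rTensor C, e.symm.toLinearMap ∘ₗ p.rTensor C,
        ⟨ModuleCat.of R (LinearMap.ker p), ⟨LinearEquiv.refl _ _⟩, hA⟩,
        ⟨h'.inj, fun x ↦ ?_, e.symm.surjective.comp h'.surj⟩,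
        ⟨P, inferInstance, ⟨LinearEquiv.refl _ _⟩⟩, hN.dualHomPerp.congr e.symm, hA.ext_tensor 0⟩
      exact (LinearEquiv.map_eq_zero_iff e.symm).trans (h'.exact x))
    (fun i hi A hA ↦ by
      obtain ⟨X, B, f, g, h, hX, hB, hSB⟩ := h𝒮 A hA.2
      refine ⟨B, X, f, g, ⟨fun n ↦ h.extVanish_to_right (hA.1 (n + 1)) ?_, hSB⟩, h, hX, hB, hA.1 0⟩
      exact ((inBassClass_iff X).mp (hC.inBassClass_of_isCFlat hX)).1 n)
  subst hS0
  refine ⟨S.toZComplex, S.toZComplex_isExact, fun i ↦ (hS i).1, fun P hP ↦ ?_, fun N hN ↦ ?_,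
    S.toZComplex_isCoker⟩
  · refine S.toZComplex_homFromExact fun i k ↦ ?_
    obtain ⟨l, hl⟩ := Module.projective_lifting_property
      (LinearMap.llcomp R C (S.X i) (S.K i) (S.π i)) (TensorProduct.curry k)
      (fun k ↦ (S.isSES i).lift_of_extVanish (hS i).2.2 k)
    refine ⟨TensorProduct.lift l, TensorProduct.ext' fun x c ↦ ?_⟩
    exact LinearMap.congr_fun (LinearMap.congr_fun hl x) c
  · exact S.toZComplex_homToExact fun i ↦ extend_of_isCFlatCotorsion
      (fun I hI ↦ (hS i).2.1.lcomp_surjective (S.isSES i) I hI) hN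

end BassClass

section Stability

variable {R : Type u} [CommRing R]

namespace IsSES

variable {A B D X Y : Type u} [AddCommGroup A] [AddCommGroup B] [AddCommGroup D]
  [AddCommGroup X] [AddCommGroup Y] [Module R A] [Module R B] [Module R D] [Module R X] [Module R Y]
  {f : A →ₗ[R] B} {g : B →ₗ[R] D}

lemma of_injective (hf : Function.Injective f) : IsSES f (LinearMap.range f).mkQ where
  inj := hf
  exact := LinearMap.exact_map_mkQ_range _
  surj := Submodule.mkQ_surjective _

lemma exists_isSES_cokernel_comp (h : IsSES f g) {i : B →ₗ[R] X} {p : X →ₗ[R] Y}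
    (h' : IsSES i p) : ∃ (a : D →ₗ[R] X ⧸ LinearMap.range (i.comp f))
      (b : (X ⧸ LinearMap.range (i.comp f)) →ₗ[R] Y), IsSES a b := by
  have hq := of_injective (f := i.comp f) (h'.inj.comp h.inj)
  obtain ⟨a, ha⟩ := exists_comp_eq_of_exact_of_surjective h.exact h.surj
    ((LinearMap.range (i.comp f)).mkQ.comp i)
    (LinearMap.ext fun x ↦ hq.exact.apply_apply_eq_zero x)
  obtain ⟨b, hb⟩ := exists_comp_eq_of_exact_of_surjective hq.exact hq.surj p
    (LinearMap.ext fun x ↦ h'.exact.apply_apply_eq_zero (f x))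
  replace ha (x : B) : a (g x) = (LinearMap.range (i.comp f)).mkQ (i x) := LinearMap.congr_fun ha x
  replace hb (x : X) : b ((LinearMap.range (i.comp f)).mkQ x) = p x := LinearMap.congr_fun hb x
  refine ⟨a, b, (injective_iff_map_eq_zero _).mpr fun d hd ↦ ?_, fun x ↦ ?_, fun y ↦ ?_⟩
  · obtain ⟨x, rfl⟩ := h.surj d
    rw [ha, hq.exact] at hd
    obtain ⟨s, hs⟩ := hd
    rw [← h'.inj hs]
    exact h.exact.apply_apply_eq_zero s
  · obtain ⟨x, rfl⟩ := hq.surj x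
    rw [hb, h'.exact x]
    constructor
    · rintro ⟨z, rfl⟩
      exact ⟨g z, ha z⟩
    · rintro ⟨d, hd⟩
      obtain ⟨z, rfl⟩ := h.surj d
      rw [← h'.exact x, ← hb, ← hd, ha, hb, h'.exact.apply_apply_eq_zero]
  · obtain ⟨x, rfl⟩ := h'.surj y
    exact ⟨_, hb x⟩

lemma exists_isSES_cokernel_prod (h : IsSES f g) {A' D' : Type u} [AddCommGroup A']
    [AddCommGroup D'] [Module R A'] [Module R D'] {i : A →ₗ[R] X} {p : X →ₗ[R] A'}
    {j : D →ₗ[R] Y} {q : Y →ₗ[R] D'} (hi : IsSES i p) (hj : IsSES j q) {l : B →ₗ[R] X}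
    (hl : l.comp f = i) : Function.Injective (l.prod (j.comp g)) ∧
      ∃ (a : A' →ₗ[R] (X × Y) ⧸ LinearMap.range (l.prod (j.comp g)))
      (b : ((X × Y) ⧸ LinearMap.range (l.prod (j.comp g))) →ₗ[R] D'), IsSES a b := by
  set k := l.prod (j.comp g) with hk
  replace hl (x : A) : l (f x) = i x := LinearMap.congr_fun hl x
  have hkf (x : A) : k (f x) = (i x, 0) := by
    simp [hk, hl, h.exact.apply_apply_eq_zero]
  have hkinj : Function.Injective k := by
    rw [injective_iff_map_eq_zero]
    intro x hx
    obtain ⟨z, rfl⟩ := (h.exact x).mp (hj.inj ((congrArg Prod.snd hx).trans (map_zero j).symm))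
    rw [hkf] at hx
    rw [hi.inj ((congrArg Prod.fst hx).trans (map_zero i).symm), map_zero]
  have hq := of_injective hkinj
  refine ⟨hkinj, ?_⟩
  obtain ⟨a, ha⟩ := exists_comp_eq_of_exact_of_surjective hi.exact hi.surj
    ((LinearMap.range k).mkQ.comp (LinearMap.inl R X Y)) (LinearMap.ext fun x ↦ by
      change (LinearMap.range k).mkQ (i x, 0) = 0
      rw [← hkf, hq.exact.apply_apply_eq_zero])
  obtain ⟨b, hb⟩ := exists_comp_eq_of_exact_of_surjective hq.exact hq.surj
    (q.comp (LinearMap.snd R X Y)) (LinearMap.ext fun x ↦ hj.exact.apply_apply_eq_zero (g x))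
  replace ha (x : X) : a (p x) = (LinearMap.range k).mkQ (x, 0) := LinearMap.congr_fun ha x
  replace hb (x : X × Y) : b ((LinearMap.range k).mkQ x) = q x.2 := LinearMap.congr_fun hb x
  refine ⟨a, b, (injective_iff_map_eq_zero _).mpr fun d hd ↦ ?_, fun z ↦ ?_, fun d ↦ ?_⟩
  · obtain ⟨x, rfl⟩ := hi.surj d
    rw [ha, hq.exact] at hd
    obtain ⟨s, hs⟩ := hd
    obtain ⟨t, rfl⟩ := (h.exact s).mp (hj.inj ((congrArg Prod.snd hs).trans (map_zero j).symm))
    rw [hkf] at hs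
    rw [← show i t = x from congrArg Prod.fst hs]
    exact hi.exact.apply_apply_eq_zero t
  · constructor
    · intro hz
      obtain ⟨⟨x, y⟩, rfl⟩ := hq.surj z
      rw [hb, hj.exact] at hz
      obtain ⟨d, hd⟩ := hz
      obtain ⟨s, rfl⟩ := h.surj d
      refine ⟨p (x - l s), ?_⟩
      have : (x, y) = (x - l s, 0) + k s := by
        ext
        · simp [hk]
        · simpa [hk] using hd.symm
      rw [ha, this, map_add, hq.exact.apply_apply_eq_zero, add_zero]
    · rintro ⟨d, rfl⟩
      obtain ⟨x, rfl⟩ := hi.surj d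
      rw [ha, hb, map_zero]
  · obtain ⟨y, rfl⟩ := hj.surj d
    exact ⟨_, hb (0, y)⟩

end IsSES

variable {C : ModuleCat.{u} R}

lemma flat_prod {F G : Type u} [AddCommGroup F] [AddCommGroup G] [Module R F] [Module R G]
    [Module.Flat R F] [Module.Flat R G] : Module.Flat R (F × G) := by
  rw [Module.Flat.iff_lTensor_injective']
  intro I
  have h : (TensorProduct.prodLeft R R F G R).toLinearMap ∘ₗ I.subtype.lTensor (F × G) =
      (I.subtype.lTensor F).prodMap (I.subtype.lTensor G) ∘ₗ
        (TensorProduct.prodLeft R R F G I).toLinearMap :=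
    TensorProduct.ext' fun _ _ ↦ rfl
  have h1 : Function.Injective
      ((TensorProduct.prodLeft R R F G R).toLinearMap ∘ₗ I.subtype.lTensor (F × G)) := by
    rw [h]
    exact (Function.Injective.prodMap
      (Module.Flat.lTensor_preserves_injective_linearMap _ Subtype.val_injective)
      (Module.Flat.lTensor_preserves_injective_linearMap _ Subtype.val_injective)).comp
        (LinearEquiv.injective _)
  rw [LinearMap.coe_comp] at h1
  exact Function.Injective.of_comp h1

lemma IsCFlat.prod {X Y : ModuleCat.{u} R} (hX : IsCFlat R C X) (hY : IsCFlat R C Y) :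
    IsCFlat R C (ModuleCat.of R (X × Y)) := by
  obtain ⟨F, _, ⟨e⟩⟩ := hX
  obtain ⟨G, _, ⟨e'⟩⟩ := hY
  exact ⟨ModuleCat.of R (F × G), flat_prod,
    ⟨(e.prodCongr e').trans (TensorProduct.prodLeft R R F G C).symm⟩⟩

/-- A `C`-flat module `Y` with `Ext^1(Z, Y) = 0` for all `Z` satisfying `DualHomPerp C`. -/
def IsCFlatPerpInjective (C Y : ModuleCat.{u} R) : Prop :=
  IsCFlat R C Y ∧ ∀ Z : ModuleCat.{u} R, DualHomPerp C Z → ExtVanish R Z Y 1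

lemma IsCFlatPerpInjective.prod {X Y : ModuleCat.{u} R} (hX : IsCFlatPerpInjective C X)
    (hY : IsCFlatPerpInjective C Y) : IsCFlatPerpInjective C (ModuleCat.of R (X × Y)) := by
  have h : IsSES (LinearMap.inl R X Y) (LinearMap.snd R X Y) :=
    ⟨LinearMap.inl_injective, .inl_snd, LinearMap.snd_surjective⟩
  exact ⟨hX.1.prod hY.1, fun Z hZ ↦ h.extVanish_to_middle (hX.2 Z hZ) (hY.2 Z hZ)⟩

lemma IsCFlat.hasPerpCoresolution {X : ModuleCat.{u} R} (hX : IsCFlat R C X) :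
    HasPerpCoresolution C (IsCFlat R C) X := by
  have hz : Module.Flat R PUnit.{u + 1} := inferInstance
  have hz' : IsCFlat R C (ModuleCat.of R PUnit.{u + 1}) :=
    ⟨ModuleCat.of R PUnit.{u + 1}, hz, ⟨0, 0, fun _ ↦ rfl, fun x ↦ Subsingleton.elim _ _⟩⟩
  refine ⟨IsCFlat R C, hX, fun S hS ↦ ⟨S, ModuleCat.of R PUnit, _, _,
    isSES_of_equiv (LinearEquiv.refl _ _), hS, dualHomPerp_of_flat (A := PUnit), hz'⟩⟩

lemma IsCFlat.exists_isCFlatPerpInjective [IsNoetherianRing R] [Module.Finite R C]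
    {X : ModuleCat.{u} R} (hX : IsCFlat R C X) : ∃ (Y D : ModuleCat.{u} R) (f : ↥X →ₗ[R] ↥Y)
      (g : ↥Y →ₗ[R] ↥D), IsSES f g ∧ IsCFlatPerpInjective C Y ∧ IsCFlat R C D := by
  obtain ⟨F, _, ⟨e⟩⟩ := hX
  let G := CharacterModule (CharacterModule F) ⧸ LinearMap.range (evalDualDual R F)
  have hG : Module.Flat R G := flat_cokernel_evalDualDual
  have h : IsSES (evalDualDual R F) (LinearMap.range (evalDualDual R F)).mkQ := isSES_evalDualDual
  let w : CharacterModule (↥C →ₗ[R] ↥(ModuleCat.of R (CharacterModule F))) ≃ₗ[R]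
      CharacterModule (CharacterModule F) ⊗[R] C :=
    (LinearEquiv.ofBijective _ tensorDualToDualHom_bijective).symm.trans
      (TensorProduct.comm R _ _)
  have hflat : Module.Flat R (CharacterModule (CharacterModule F)) :=
    flat_characterModule_of_injective
  refine ⟨ModuleCat.of R (CharacterModule (CharacterModule F) ⊗[R] C), ModuleCat.of R (G ⊗[R] C),
    (evalDualDual R F).rTensor C ∘ₗ e.toLinearMap,
    (LinearMap.range (evalDualDual R F)).mkQ.rTensor C, ⟨?_, fun x ↦ ?_, ?_⟩,
    ⟨⟨ModuleCat.of R (CharacterModule (CharacterModule F)), hflat, ⟨LinearEquiv.refl _ _⟩⟩,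
      fun Z hZ ↦ ?_⟩, ⟨ModuleCat.of R G, hG, ⟨LinearEquiv.refl _ _⟩⟩⟩
  · have : Function.Injective ((evalDualDual R F).rTensor C) :=
      rTensor_injective_iff_lcomp_surjective.mpr
        fun k ↦ h.extend_of_extVanish (extPosVanish_characterModule 0) k
    exact this.comp e.injective
  · refine (rTensor_exact C h.exact h.surj x).trans ?_
    exact (e.surjective.exists (p := fun y ↦ (evalDualDual R F).rTensor C y = x))
  · exact LinearMap.rTensor_surjective C h.surj
  · exact (hZ (ModuleCat.of R (CharacterModule F)) inferInstance 0).congr (LinearEquiv.refl _ _) w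

/-- The modules built by extensions from those in `𝒮` and those with a coresolution by `C`-flat
modules, all satisfying `DualHomPerp C`. -/
inductive PerpExtensionClosure (C : ModuleCat.{u} R) (𝒮 : ModuleCat.{u} R → Prop) :
    ModuleCat.{u} R → Prop
  | base {S : ModuleCat.{u} R} : 𝒮 S → DualHomPerp C S → PerpExtensionClosure C 𝒮 S
  | cores {S : ModuleCat.{u} R} : DualHomPerp C S → HasPerpCoresolution C (IsCFlat R C) S →
      PerpExtensionClosure C 𝒮 S
  | extension {A B D : ModuleCat.{u} R} {f : ↥A →ₗ[R] ↥B} {g : ↥B →ₗ[R] ↥D} : IsSES f g →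
      PerpExtensionClosure C 𝒮 A → PerpExtensionClosure C 𝒮 D → PerpExtensionClosure C 𝒮 B

namespace PerpExtensionClosure

variable {𝒮 : ModuleCat.{u} R → Prop}

lemma dualHomPerp {S : ModuleCat.{u} R} (h : PerpExtensionClosure C 𝒮 S) : DualHomPerp C S := by
  induction h with
  | base _ h => exact h
  | cores h _ => exact h
  | extension h _ _ hA hD => exact .middle h hA hD

lemma exists_of_cores [IsNoetherianRing R] (hC : IsSemidualizing R C) {X : ModuleCat.{u} R}
    (hX : HasPerpCoresolution C (IsCFlat R C) X) :
    ∃ (Y D : ModuleCat.{u} R) (f : ↥X →ₗ[R] ↥Y) (g : ↥Y →ₗ[R] ↥D), IsSES f g ∧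
      IsCFlatPerpInjective C Y ∧ PerpExtensionClosure C 𝒮 D := by
  have := hC.finite
  obtain ⟨𝒯, hT, h𝒯⟩ := hX
  obtain ⟨X', S', f, g, h, hX', hS', hTS'⟩ := h𝒯 X hT
  obtain ⟨Y, D, i, p, hi, hY, hD⟩ := hX'.exists_isCFlatPerpInjective
  obtain ⟨a, b, hab⟩ := h.exists_isSES_cokernel_comp hi
  exact ⟨Y, ModuleCat.of R (Y ⧸ LinearMap.range (i.comp f)), _, _,
    .of_injective (hi.inj.comp h.inj), hY, .extension (A := S') (D := D) hab
      (.cores hS' ⟨𝒯, hTS', h𝒯⟩) (.cores (hC.dualHomPerp_of_isCFlat hD)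
        hD.hasPerpCoresolution)⟩

lemma exists_isSES [IsNoetherianRing R] (hC : IsSemidualizing R C)
    (h𝒮 : ∀ S, 𝒮 S → ∃ (X S' : ModuleCat.{u} R) (f : ↥S →ₗ[R] ↥X) (g : ↥X →ₗ[R] ↥S'), IsSES f g ∧
      HasPerpCoresolution C (IsCFlat R C) X ∧ DualHomPerp C S' ∧ 𝒮 S')
    {S : ModuleCat.{u} R} (hS : PerpExtensionClosure C 𝒮 S) :
    ∃ (Y D : ModuleCat.{u} R) (f : ↥S →ₗ[R] ↥Y) (g : ↥Y →ₗ[R] ↥D), IsSES f g ∧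
      IsCFlatPerpInjective C Y ∧ PerpExtensionClosure C 𝒮 D := by
  induction hS with
  | @base S hS _ =>
    obtain ⟨X, S', f, g, h, hX, hS', h𝒮S'⟩ := h𝒮 S hS
    obtain ⟨Y, D, i, p, hi, hY, hD⟩ := exists_of_cores (𝒮 := 𝒮) hC hX
    obtain ⟨a, b, hab⟩ := h.exists_isSES_cokernel_comp hi
    exact ⟨Y, ModuleCat.of R (Y ⧸ LinearMap.range (i.comp f)), _, _,
      .of_injective (hi.inj.comp h.inj), hY, .extension (A := S') (D := D) hab
        (.base h𝒮S' hS') hD⟩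
  | cores _ hS => exact exists_of_cores hC hS
  | @extension A B D f g h _ hTD hA hD =>
    obtain ⟨Y₁, A', i, p, hi, hY₁, hA'⟩ := hA
    obtain ⟨Y₂, D', j, q, hj, hY₂, hD'⟩ := hD
    obtain ⟨l, hl⟩ := h.extend_of_extVanish (hY₁.2 D hTD.dualHomPerp) i
    obtain ⟨hk, a, b, hab⟩ := h.exists_isSES_cokernel_prod hi hj hl
    exact ⟨ModuleCat.of R (Y₁ × Y₂),
      ModuleCat.of R ((Y₁ × Y₂) ⧸ LinearMap.range (l.prod (j.comp g))), _, _, .of_injective hk,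
      hY₁.prod hY₂, .extension (A := A') (D := D') hab hA' hD'⟩

end PerpExtensionClosure

lemma HasPerpCoresolution.trans [IsNoetherianRing R] (hC : IsSemidualizing R C)
    {𝒳 : ModuleCat.{u} R → Prop} (h𝒳 : ∀ X, 𝒳 X → HasPerpCoresolution C (IsCFlat R C) X)
    {M : ModuleCat.{u} R} (hM : DualHomPerp C M) (h : HasPerpCoresolution C 𝒳 M) :
    HasPerpCoresolution C (IsCFlat R C) M := by
  obtain ⟨𝒮, h𝒮M, h𝒮⟩ := h
  refine ⟨PerpExtensionClosure C 𝒮, .base h𝒮M hM, fun S hS ↦ ?_⟩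
  obtain ⟨Y, D, f, g, h, hY, hD⟩ := hS.exists_isSES hC fun S hS ↦ by
    obtain ⟨X, S', f, g, h, hX, h'⟩ := h𝒮 S hS
    exact ⟨X, S', f, g, h, h𝒳 X hX, h'⟩
  exact ⟨Y, D, f, g, h, hY.1, hD.dualHomPerp, hD⟩

lemma HClass.mono {𝒳 𝒴 : ModuleCat.{u} R → Prop} (h : ∀ X, 𝒳 X → 𝒴 X) {M : ModuleCat.{u} R}
    (hM : HClass R C 𝒳 M) : HClass R C 𝒴 M := by
  obtain ⟨Z, hZ, hX, h'⟩ := hM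
  exact ⟨Z, hZ, fun i ↦ h _ (hX i), h'⟩

lemma IsSemidualizing.hClass_isCFlat_iff [IsNoetherianRing R] (hC : IsSemidualizing R C)
    (M : ModuleCat.{u} R) :
    HClass R C (IsCFlat R C) M ↔ IsGCFlat R C M ∧ InBassClass R C M := by
  rw [hC.isGCFlat_iff]
  constructor
  · intro h
    have := hC.of_hClass (fun X hX ↦ ⟨hC.inBassClass_of_isCFlat hX,
      hC.dualHomPerp_of_isCFlat hX⟩) h
    exact ⟨this.2, this.1⟩
  · exact fun h ↦ hC.hClass_isCFlat h.2 h.1.1 h.1.2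

lemma IsSemidualizing.hClass_isGCFlat_iff [IsNoetherianRing R] (hC : IsSemidualizing R C)
    (M : ModuleCat.{u} R) :
    HClass R C (fun X ↦ IsGCFlat R C X ∧ InBassClass R C X) M ↔
      IsGCFlat R C M ∧ InBassClass R C M := by
  constructor
  · intro h
    obtain ⟨h1, h2, h3⟩ := hC.of_hClass (fun X hX ↦ ⟨hX.2, ((hC.isGCFlat_iff X).mp hX.1).1⟩) h
    exact ⟨(hC.isGCFlat_iff M).mpr ⟨h2, .trans hC
      (fun X hX ↦ ((hC.isGCFlat_iff X).mp hX.1).2) h2 h3⟩, h1⟩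
  · intro h
    refine HClass.mono (fun X hX ↦ ⟨(hC.isGCFlat_iff X).mpr ⟨hC.dualHomPerp_of_isCFlat hX,
      hX.hasPerpCoresolution⟩, hC.inBassClass_of_isCFlat hX⟩)
      ((hC.hClass_isCFlat_iff M).mpr h)

end Stability

/-- For `n ≥ 1`, `H_C^n(F_C(R)) = GF_C(R) ∩ B_C(R)`. -/
theorem stmt19 (R : Type u) [CommRing R] [IsNoetherianRing R]
    (C : ModuleCat.{u} R) (hC : IsSemidualizing R C) (n : ℕ) (hn : 1 ≤ n)
    (M : ModuleCat.{u} R) :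
    HIter R C n (IsCFlat R C) M ↔ (IsGCFlat R C M ∧ InBassClass R C M) := by
  induction n, hn using Nat.le_induction generalizing M with
  | base => exact hC.hClass_isCFlat_iff M
  | succ n _ ih =>
    have h : HIter R C n (IsCFlat R C) = fun X ↦ IsGCFlat R C X ∧ InBassClass R C X :=
      funext fun X ↦ propext (ih X)
    change HClass R C (HIter R C n (IsCFlat R C)) M ↔ _
    rw [h]
    exact hC.hClass_isGCFlat_iff M
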